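/- Let k, m be integers with m ≥ k > n/2 − 1. Then: (a) there is a constant C such that every holomorphic F on T_Λ with sup_{z} Δ(Im z)^k |□^k F(z)| < ∞ satisfies sup_{z ∈ T_Λ} Δ(Im z)^k |□^k F(z)| ≤ C sup_{z ∈ T_Λ} Δ(Im z)^m |□^m F(z)|; and (b) for every holomorphic F on T_Λ with sup_{z} Δ(Im z)^m |□^m F(z)| < ∞ there exists a holomorphic G on T_Λ with □^m G = □^m F and sup_{z} Δ(Im z)^k |□^k G(z)| < ∞. -/

import Mathlib

open MeasureTheory Complex Set
open scoped ENNReal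

noncomputable section

/-- The Lorentz form `Δ(y) = y₁² − y₂² − ⋯ − yₙ²` on `ℝⁿ`
(written as `2 y₀² − ∑ yᵢ²` with 0-based indexing). -/
def lor {n : ℕ} [NeZero n] (y : Fin n → ℝ) : ℝ := 2 * y 0 ^ 2 - ∑ i, y i ^ 2

/-- The holomorphic extension of the Lorentz form to `ℂⁿ`. -/
def lorC {n : ℕ} [NeZero n] (z : Fin n → ℂ) : ℂ := 2 * z 0 ^ 2 - ∑ i, z i ^ 2

/-- Componentwise imaginary part. -/
def imP {n : ℕ} (z : Fin n → ℂ) : Fin n → ℝ := fun i => (z i).im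

/-- The forward light cone `Λ`. -/
def cone (n : ℕ) [NeZero n] : Set (Fin n → ℝ) := {y | 0 < lor y ∧ 0 < y 0}

/-- The tube domain `T_Λ` over the forward light cone. -/
def tube (n : ℕ) [NeZero n] : Set (Fin n → ℂ) := {z | imP z ∈ cone n}

/-- The weighted measure `dV_ν = Δ(Im z)^{ν − n/2} dz` on `T_Λ`. -/
def dV (n : ℕ) [NeZero n] (ν : ℝ) : Measure (Fin n → ℂ) :=
  ((volume : Measure (Fin n → ℂ)).restrict (tube n)).withDensity
    (fun z => ENNReal.ofReal (lor (imP z) ^ (ν - (n : ℝ) / 2)))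

/-- `∫ |F|^p dV_ν` (as an extended nonnegative real). -/
def lpInt (n : ℕ) [NeZero n] (p ν : ℝ) (F : (Fin n → ℂ) → ℂ) : ℝ≥0∞ :=
  ∫⁻ z, ENNReal.ofReal (‖F z‖ ^ p) ∂(dV n ν)

/-- The `L^p_ν` norm `(∫ |F|^p dV_ν)^{1/p}`. -/
def lpNorm (n : ℕ) [NeZero n] (p ν : ℝ) (F : (Fin n → ℂ) → ℂ) : ℝ≥0∞ :=
  (lpInt n p ν F) ^ (1 / p)

/-- The Bergman space `A^p_ν`: holomorphic on `T_Λ` and in `L^p_ν`. -/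
def memA (n : ℕ) [NeZero n] (p ν : ℝ) (F : (Fin n → ℂ) → ℂ) : Prop :=
  DifferentiableOn ℂ F (tube n) ∧ lpInt n p ν F < ⊤

/-- Partial derivative `∂/∂zᵢ`. -/
def pd {n : ℕ} (i : Fin n) (F : (Fin n → ℂ) → ℂ) : (Fin n → ℂ) → ℂ :=
  fun z => fderiv ℂ F z (Pi.single i 1)

/-- The wave (Box) operator `□ = −(∂₁² − ∂₂² − ⋯ − ∂ₙ²)`, so that
`□ e^{i z·ξ} = Δ(ξ) e^{i z·ξ}`. -/
def BoxOp {n : ℕ} [NeZero n] (F : (Fin n → ℂ) → ℂ) : (Fin n → ℂ) → ℂ :=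
  fun z => -(2 * pd 0 (pd 0 F) z - ∑ i, pd i (pd i F) z)

/-- The (unnormalized) Bergman kernel `B_β(z,w) = Δ((z − w̄)/i)^{−(β+n)}`. -/
def berg (n : ℕ) [NeZero n] (β : ℝ) (z w : Fin n → ℂ) : ℂ :=
  lorC (fun i => (z i - (starRingEnd ℂ) (w i)) / Complex.I) ^ (-(β + (n : ℝ)) : ℂ)

/-- The Hardy inequality holds for `(p, ν)`:
`∫ |F|^p dV_ν ≤ C ∫ |Δ(Im z) □F(z)|^p dV_ν(z)` for all `F ∈ A^p_ν`. -/
def hardy (n : ℕ) [NeZero n] (p ν : ℝ) : Prop :=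
  ∃ C > (0 : ℝ), ∀ F, memA n p ν F →
    lpInt n p ν F ≤ ENNReal.ofReal C *
      lpInt n p ν (fun z => (lor (imP z) : ℂ) * BoxOp F z)

/-- `g` is the orthogonal projection of `f ∈ L²_ν` onto the closed subspace `A²_ν`:
`g ∈ A²_ν` and `f − g ⊥ A²_ν`. -/
def isProj (n : ℕ) [NeZero n] (ν : ℝ) (f g : (Fin n → ℂ) → ℂ) : Prop :=
  memA n 2 ν g ∧ ∀ h, memA n 2 ν h →
    ∫ z, f z * (starRingEnd ℂ) (h z) ∂(dV n ν) =
      ∫ z, g z * (starRingEnd ℂ) (h z) ∂(dV n ν)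

/-- The Bergman projection `P_ν` admits a bounded extension to `L^p_ν`:
`‖P_ν f‖_{L^p_ν} ≤ C ‖f‖_{L^p_ν}` for all `f ∈ L²_ν ∩ L^p_ν`. -/
def projBounded (n : ℕ) [NeZero n] (p ν : ℝ) : Prop :=
  ∃ C > (0 : ℝ), ∀ f g : (Fin n → ℂ) → ℂ,
    AEStronglyMeasurable f (dV n ν) → lpInt n 2 ν f < ⊤ → lpInt n p ν f < ⊤ →
    isProj n ν f g → lpNorm n p ν g ≤ ENNReal.ofReal C * lpNorm n p ν f

/-- A bounded (continuous) linear functional on `A^p_ν`. -/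
def isBddFunc (n : ℕ) [NeZero n] (p ν : ℝ) (γ : ((Fin n → ℂ) → ℂ) → ℂ) : Prop :=
  (∀ F G, memA n p ν F → memA n p ν G → γ (F + G) = γ F + γ G) ∧
  (∀ (c : ℂ) (F), memA n p ν F → γ (fun z => c * F z) = c * γ F) ∧
  ∃ C : ℝ, ∀ F, memA n p ν F → ‖γ F‖ ≤ C * (lpNorm n p ν F).toReal

/-! ### Directional derivatives of holomorphic functions of several variables -/

/-- The complex derivative of `F` in the direction `v`. -/
def dirD {ι : Type*} [Fintype ι] (v : ι → ℂ) (F : (ι → ℂ) → ℂ) : (ι → ℂ) → ℂ :=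
  fun z => fderiv ℂ F z v

section ParametricIntegrals

variable {ι : Type*} [Fintype ι] {U : Set (ι → ℂ)} {X : Type*} [MeasurableSpace X]
  {μ : Measure X}

lemma clm_apply_eq_sum [DecidableEq ι] (L : (ι → ℂ) →L[ℂ] ℂ) (v : ι → ℂ) :
    L v = ∑ i, L (Pi.single i 1) * v i := by
  have hv : v = ∑ i, v i • (Pi.single i 1 : ι → ℂ) := by
    ext j
    simp [Finset.sum_apply, Pi.single_apply]
  conv_lhs => rw [hv]
  simp [map_sum, mul_comm]

lemma hasDerivAt_comp_line {f : (ι → ℂ) → ℂ} (hU : IsOpen U) (hf : DifferentiableOn ℂ f U)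
    {z v : ι → ℂ} {ζ : ℂ} (hz : z + ζ • v ∈ U) :
    HasDerivAt (fun ζ : ℂ => f (z + ζ • v)) (dirD v f (z + ζ • v)) ζ := by
  have h1 : HasFDerivAt f (fderiv ℂ f (z + ζ • v)) (z + ζ • v) :=
    ((hf _ hz).differentiableAt (hU.mem_nhds hz)).hasFDerivAt
  have h2 : HasDerivAt (fun ζ : ℂ => z + ζ • v) v ζ := by
    simpa using ((hasDerivAt_id ζ).smul_const v).const_add z
  exact h1.comp_hasDerivAt ζ h2

/-- Cauchy's estimate along a complex line. -/
lemma norm_dirD_le {f : (ι → ℂ) → ℂ} (hU : IsOpen U) (hf : DifferentiableOn ℂ f U)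
    {z v : ι → ℂ} {R B : ℝ} (hR : 0 < R)
    (h : ∀ ζ : ℂ, ‖ζ‖ ≤ R → z + ζ • v ∈ U ∧ ‖f (z + ζ • v)‖ ≤ B) :
    ‖dirD v f z‖ ≤ B / R := by
  have hd : ∀ ζ : ℂ, ‖ζ‖ ≤ R → HasDerivAt (fun ζ : ℂ => f (z + ζ • v))
      (dirD v f (z + ζ • v)) ζ := fun ζ hζ => hasDerivAt_comp_line hU hf (h ζ hζ).1
  have h0 := (hd 0 (by simpa using hR.le)).deriv
  simp only [zero_smul, add_zero] at h0
  rw [← h0]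
  refine Complex.norm_deriv_le_of_forall_mem_sphere_norm_le hR ?_ ?_
  · refine DifferentiableOn.diffContOnCl ?_
    rw [closure_ball _ hR.ne']
    intro ζ hζ
    exact (hd ζ (by simpa using hζ)).differentiableAt.differentiableWithinAt
  · intro ζ hζ
    exact (h ζ (by simpa using hζ.le)).2

lemma dirD_congr {f g : (ι → ℂ) → ℂ} (hU : IsOpen U) (h : EqOn f g U) (v : ι → ℂ) :
    EqOn (dirD v f) (dirD v g) U := by
  intro z hz
  simp only [dirD]
  rw [(h.eventuallyEq_of_mem (hU.mem_nhds hz)).fderiv_eq]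

lemma norm_fderiv_le {f : (ι → ℂ) → ℂ} {c : ι → ℂ} {r B : ℝ} (hr : 0 < r)
    (hf : DifferentiableOn ℂ f (Metric.ball c r)) (hB : ∀ z ∈ Metric.ball c r, ‖f z‖ ≤ B)
    {z : ι → ℂ} (hz : z ∈ Metric.ball c (r / 2)) : ‖fderiv ℂ f z‖ ≤ B * (4 / r) := by
  have hB0 : 0 ≤ B := (norm_nonneg _).trans (hB c (Metric.mem_ball_self hr))
  refine ContinuousLinearMap.opNorm_le_bound _ (by positivity) fun v => ?_
  rcases eq_or_ne v 0 with rfl | hv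
  · simp
  have hv' : 0 < ‖v‖ := norm_pos_iff.2 hv
  have key : ‖dirD v f z‖ ≤ B / (r / 4 / ‖v‖) := by
    refine norm_dirD_le Metric.isOpen_ball hf (by positivity) fun ζ hζ => ?_
    have hm : z + ζ • v ∈ Metric.ball c r := by
      rw [Metric.mem_ball, dist_eq_norm] at hz ⊢
      have : ‖ζ • v‖ ≤ r / 4 := by
        rw [norm_smul]
        calc ‖ζ‖ * ‖v‖ ≤ r / 4 / ‖v‖ * ‖v‖ := by gcongr
          _ = r / 4 := by field_simp
      calc ‖z + ζ • v - c‖ = ‖(z - c) + ζ • v‖ := by congr 1; abel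
        _ ≤ ‖z - c‖ + ‖ζ • v‖ := norm_add_le _ _
        _ < r := by linarith
    exact ⟨hm, hB _ hm⟩
  calc ‖fderiv ℂ f z v‖ ≤ B / (r / 4 / ‖v‖) := key
    _ = B * (4 / r) * ‖v‖ := by field_simp

/-- A family of holomorphic functions on `U` that is measurable and locally dominated by an
integrable function of the parameter. -/
structure HolFamily (U : Set (ι → ℂ)) (μ : Measure X) (F : (ι → ℂ) → X → ℂ) : Prop where
  diff : ∀ᵐ x ∂μ, DifferentiableOn ℂ (fun z => F z x) U
  meas : ∀ z ∈ U, AEStronglyMeasurable (F z) μ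
  dom : ∀ z ∈ U, ∃ r > 0, ∃ b : X → ℝ, Integrable b μ ∧
    ∀ᵐ x ∂μ, ∀ w ∈ Metric.ball z r, ‖F w x‖ ≤ b x

namespace HolFamily

variable {F : (ι → ℂ) → X → ℂ}

lemma integrable (h : HolFamily U μ F) {z : ι → ℂ} (hz : z ∈ U) : Integrable (F z) μ := by
  obtain ⟨r, hr, b, hb, hd⟩ := h.dom z hz
  refine hb.mono' (h.meas z hz) ?_
  filter_upwards [hd] with x hx using hx z (Metric.mem_ball_self hr)

lemma dom_fderiv (hU : IsOpen U) (h : HolFamily U μ F) {z : ι → ℂ} (hz : z ∈ U) :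
    ∃ r > 0, Metric.ball z r ⊆ U ∧ ∃ b : X → ℝ, Integrable b μ ∧
      ∀ᵐ x ∂μ, ∀ w ∈ Metric.ball z r, ‖fderiv ℂ (fun z => F z x) w‖ ≤ b x := by
  obtain ⟨r, hr, b, hb, hd⟩ := h.dom z hz
  obtain ⟨s, hs, hsU⟩ := Metric.isOpen_iff.1 hU z hz
  set t := min r s
  have ht : 0 < t := lt_min hr hs
  refine ⟨t / 2, by positivity,
    (Metric.ball_subset_ball ((half_le_self ht.le).trans (min_le_right _ _))).trans hsU,
    fun x => b x * (4 / t), hb.mul_const _, ?_⟩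
  filter_upwards [hd, h.diff] with x hx hdx w hw
  exact norm_fderiv_le ht
    (hdx.mono ((Metric.ball_subset_ball (min_le_right _ _)).trans hsU))
    (fun z hz => hx z (Metric.ball_subset_ball (min_le_left _ _) hz)) hw

lemma meas_dirD (hU : IsOpen U) (h : HolFamily U μ F) {z : ι → ℂ} (hz : z ∈ U) (v : ι → ℂ) :
    AEStronglyMeasurable (fun x => fderiv ℂ (fun z => F z x) z v) μ := by
  have hc : Filter.Tendsto (fun n : ℕ => ‖((n : ℂ))‖) Filter.atTop Filter.atTop := by
    simpa using tendsto_natCast_atTop_atTop (R := ℝ)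
  have hlim : Filter.Tendsto (fun n : ℕ => z + ((n : ℂ))⁻¹ • v) Filter.atTop (nhds z) := by
    have h1 : Filter.Tendsto (fun n : ℕ => ((n : ℂ))⁻¹) Filter.atTop (nhds 0) :=
      tendsto_inv_atTop_nhds_zero_nat (𝕜 := ℂ)
    simpa using (h1.smul_const v).const_add z
  obtain ⟨N, hN⟩ := Filter.eventually_atTop.1 (hlim.eventually (hU.mem_nhds hz))
  refine aestronglyMeasurable_of_tendsto_ae Filter.atTop
    (f := fun n x => ((n + N : ℕ) : ℂ) • (F (z + (((n + N : ℕ) : ℂ))⁻¹ • v) x - F z x)) ?_ ?_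
  · intro n
    have h1 := (h.meas _ (hN (n + N) (Nat.le_add_left _ _))).sub (h.meas z hz)
    exact AEStronglyMeasurable.const_smul h1 (((n + N : ℕ) : ℂ))
  · filter_upwards [h.diff] with x hx
    have h1 := ((hx z hz).differentiableAt (hU.mem_nhds hz)).hasFDerivAt
    exact h1.lim v (hc.comp (Filter.tendsto_add_atTop_nat N))

lemma hasFDerivAt [DecidableEq ι] (hU : IsOpen U) (h : HolFamily U μ F) {z : ι → ℂ}
    (hz : z ∈ U) :
    Integrable (fun x => fderiv ℂ (fun z => F z x) z) μ ∧
    HasFDerivAt (fun z => ∫ x, F z x ∂μ) (∫ x, fderiv ℂ (fun z => F z x) z ∂μ) z := by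
  obtain ⟨r, hr, hrU, b, hb, hd⟩ := h.dom_fderiv hU hz
  have hmeas : AEStronglyMeasurable (fun x => fderiv ℂ (fun z => F z x) z) μ := by
    have : (fun x => fderiv ℂ (fun z => F z x) z) = fun x => ∑ i,
        (fderiv ℂ (fun z => F z x) z (Pi.single i 1)) •
          (ContinuousLinearMap.proj i : (ι → ℂ) →L[ℂ] ℂ) := by
      funext x
      ext v
      simpa using clm_apply_eq_sum _ v
    rw [this]
    refine Finset.aestronglyMeasurable_fun_sum _ fun i _ => ?_
    exact (h.meas_dirD hU hz _).smul_const _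
  refine ⟨hb.mono' hmeas ?_, ?_⟩
  · filter_upwards [hd] with x hx using hx z (Metric.mem_ball_self hr)
  refine hasFDerivAt_integral_of_dominated_of_fderiv_le
    (F' := fun w x => fderiv ℂ (fun z => F z x) w) (Metric.ball_mem_nhds z hr) ?_ (h.integrable hz)
    hmeas hd hb ?_
  · filter_upwards [hU.mem_nhds hz] with w hw using h.meas w hw
  · filter_upwards [h.diff] with x hx w hw
    exact ((hx w (hrU hw)).differentiableAt (hU.mem_nhds (hrU hw))).hasFDerivAt

lemma differentiableOn (hU : IsOpen U) (h : HolFamily U μ F) :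
    DifferentiableOn ℂ (fun z => ∫ x, F z x ∂μ) U := by
  classical
  exact fun z hz => (h.hasFDerivAt hU hz).2.differentiableAt.differentiableWithinAt

lemma dirD_integral (hU : IsOpen U) (h : HolFamily U μ F) (v : ι → ℂ) :
    EqOn (dirD v (fun z => ∫ x, F z x ∂μ)) (fun z => ∫ x, dirD v (fun z => F z x) z ∂μ) U := by
  classical
  intro z hz
  obtain ⟨h1, h2⟩ := h.hasFDerivAt hU hz
  simp only [dirD]
  rw [h2.fderiv, ContinuousLinearMap.integral_apply h1]

end HolFamily

/-- Directional derivatives of holomorphic functions are holomorphic. -/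
lemma differentiableOn_dirD (hU : IsOpen U) {f : (ι → ℂ) → ℂ} (hf : DifferentiableOn ℂ f U)
    (v : ι → ℂ) : DifferentiableOn ℂ (dirD v f) U := by
  intro z₀ hz₀
  refine DifferentiableAt.differentiableWithinAt ?_
  obtain ⟨s, hs, hsU⟩ := Metric.isOpen_iff.1 hU z₀ hz₀
  set r := s / 4 with hr
  have hr0 : 0 < r := by positivity
  set R := r / (‖v‖ + 1) with hR
  have hR0 : 0 < R := by positivity
  have hmem : ∀ z ∈ Metric.ball z₀ r, ∀ ζ ∈ Metric.ball (0 : ℂ) (2 * R),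
      z + ζ • v ∈ Metric.closedBall z₀ (3 * r) := by
    intro z hz ζ hζ
    rw [Metric.mem_ball, dist_eq_norm] at hz
    rw [Metric.mem_closedBall, dist_eq_norm]
    have h1 : ‖ζ • v‖ ≤ 2 * r := by
      rw [norm_smul]
      have h2 : ‖ζ‖ ≤ 2 * R := by simpa using (Metric.mem_ball.1 hζ).le
      calc ‖ζ‖ * ‖v‖ ≤ (2 * R) * (‖v‖ + 1) := by gcongr; linarith
        _ = 2 * r := by rw [hR]; field_simp
    calc ‖z + ζ • v - z₀‖ = ‖(z - z₀) + ζ • v‖ := by congr 1; abel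
      _ ≤ ‖z - z₀‖ + ‖ζ • v‖ := norm_add_le _ _
      _ ≤ 3 * r := by linarith
  have hsub : Metric.closedBall z₀ (3 * r) ⊆ U :=
    (Metric.closedBall_subset_ball (by linarith)).trans hsU
  obtain ⟨B, hB⟩ := (isCompact_closedBall z₀ (3 * r)).exists_bound_of_continuousOn
    (hf.continuousOn.mono hsub)
  let G : (ι → ℂ) → ℝ → ℂ := fun z θ =>
    (2 * Real.pi * Complex.I)⁻¹ *
      (deriv (circleMap 0 R) θ * ((circleMap 0 R θ ^ 2)⁻¹ * f (z + circleMap 0 R θ • v)))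
  have hcm : ∀ θ, circleMap 0 R θ ∈ Metric.ball (0 : ℂ) (2 * R) := fun θ => by
    simp [abs_of_pos hR0]; linarith
  have hG : HolFamily (Metric.ball z₀ r) (volume.restrict (Ioc 0 (2 * Real.pi))) G := by
    refine ⟨Filter.Eventually.of_forall fun θ => ?_, fun z hz => ?_, fun z hz => ?_⟩
    · have h1 : DifferentiableOn ℂ (fun z => f (z + circleMap 0 R θ • v)) (Metric.ball z₀ r) :=
        hf.comp (by fun_prop) fun z hz => hsub (hmem z hz _ (hcm θ))
      exact ((h1.const_mul _).const_mul _).const_mul _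
    · refine Continuous.aestronglyMeasurable ?_
      have h1 : Continuous fun θ : ℝ => f (z + circleMap 0 R θ • v) :=
        hf.continuousOn.comp_continuous (by fun_prop) fun θ => hsub (hmem z hz _ (hcm θ))
      have h2 : Continuous fun θ : ℝ => (circleMap 0 R θ ^ 2)⁻¹ :=
        Continuous.inv₀ (by fun_prop) fun θ => by simp [hR0.ne']
      have h3 : Continuous (circleMap 0 R) := continuous_circleMap 0 R
      simp only [G, deriv_circleMap]
      exact continuous_const.mul ((h3.mul continuous_const).mul (h2.mul h1))
    · obtain ⟨t, ht, htU⟩ := Metric.isOpen_iff.1 Metric.isOpen_ball z hz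
      refine ⟨t, ht, fun _ => ‖(2 * Real.pi * Complex.I : ℂ)⁻¹‖ * (R * ((R ^ 2)⁻¹ * B)),
        integrable_const _, Filter.Eventually.of_forall fun θ w hw => ?_⟩
      have := hB _ (hmem w (htU hw) _ (hcm θ))
      simp only [G, deriv_circleMap, norm_mul, norm_circleMap_zero, norm_inv, norm_pow,
        Complex.norm_I, mul_one, abs_of_pos hR0]
      gcongr
  have heq : EqOn (dirD v f) (fun z => ∫ θ in Ioc 0 (2 * Real.pi), G z θ) (Metric.ball z₀ r) := by
    intro z hz
    have hV : IsOpen (Metric.ball (0 : ℂ) (2 * R)) := Metric.isOpen_ball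
    have hd : ∀ ζ ∈ Metric.ball (0 : ℂ) (2 * R), HasDerivAt (fun ζ : ℂ => f (z + ζ • v))
      (dirD v f (z + ζ • v)) ζ := fun ζ hζ =>
        hasDerivAt_comp_line hU hf (hsub (hmem z hz ζ hζ))
    have h0 := (hd 0 (Metric.mem_ball_self (by positivity))).deriv
    simp only [zero_smul, add_zero] at h0
    rw [← h0, ← Complex.two_pi_I_inv_smul_circleIntegral_sub_sq_inv_smul_of_differentiable hV
      (c := 0) (R := R) (w₀ := 0) (Metric.closedBall_subset_ball (by linarith))
      (fun ζ hζ => (hd ζ hζ).differentiableAt.differentiableWithinAt)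
      (Metric.mem_ball_self hR0)]
    rw [circleIntegral, intervalIntegral.integral_of_le Real.two_pi_pos.le]
    simp only [G, smul_eq_mul, sub_zero]
    rw [integral_const_mul]
  have h2 := (hG.differentiableOn Metric.isOpen_ball).congr heq
  exact (h2 z₀ (Metric.mem_ball_self hr0)).differentiableAt (Metric.ball_mem_nhds _ hr0)

lemma HolFamily.dirD (hU : IsOpen U) {F : (ι → ℂ) → X → ℂ} (h : HolFamily U μ F)
    (v : ι → ℂ) : HolFamily U μ (fun z x => dirD v (fun z => F z x) z) := by
  refine ⟨?_, fun z hz => h.meas_dirD hU hz v, fun z hz => ?_⟩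
  · filter_upwards [h.diff] with x hx using differentiableOn_dirD hU hx v
  · obtain ⟨r, hr, -, b, hb, hd⟩ := h.dom_fderiv hU hz
    refine ⟨r, hr, fun x => b x * ‖v‖, hb.mul_const _, ?_⟩
    filter_upwards [hd] with x hx w hw
    exact ContinuousLinearMap.le_of_opNorm_le _ (hx w hw) v

lemma dirD_comm [DecidableEq ι] (hU : IsOpen U) {f : (ι → ℂ) → ℂ}
    (hf : DifferentiableOn ℂ f U) (v w : ι → ℂ) {z : ι → ℂ} (hz : z ∈ U) :
    dirD v (dirD w f) z = dirD w (dirD v f) z := by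
  have hcoe : fderiv ℂ f = fun z => ∑ i, (_root_.dirD (Pi.single i 1) f z) •
          (ContinuousLinearMap.proj i : (ι → ℂ) →L[ℂ] ℂ) := by
    funext x
    ext v
    simpa [_root_.dirD] using clm_apply_eq_sum _ v
  have hd : DifferentiableAt ℂ (fderiv ℂ f) z := by
    rw [hcoe]
    refine DifferentiableAt.fun_sum fun i _ => ?_
    exact ((differentiableOn_dirD hU hf _ z hz).differentiableAt (hU.mem_nhds hz)).smul_const _
  have h1 := second_derivative_symmetric_of_eventually (f := f) (f' := fderiv ℂ f) (x := z)
    (f'' := fderiv ℂ (fderiv ℂ f) z) (by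
      filter_upwards [hU.mem_nhds hz] with y hy
      exact ((hf y hy).differentiableAt (hU.mem_nhds hy)).hasFDerivAt) hd.hasFDerivAt v w
  have h2 : ∀ v w, _root_.dirD v (_root_.dirD w f) z = fderiv ℂ (fderiv ℂ f) z v w := by
    intro v w
    have := (hd.hasFDerivAt.clm_apply (hasFDerivAt_const w z)).fderiv
    change fderiv ℂ (fun y => fderiv ℂ f y w) z v = _
    rw [this]
    simp
  rw [h2, h2, h1]

end ParametricIntegrals

/-! ### The wave operator on the tube domain -/

section Wave

variable {n : ℕ} {U : Set (Fin n → ℂ)}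

lemma continuous_imP : Continuous (imP : (Fin n → ℂ) → Fin n → ℝ) := by
  unfold imP; fun_prop

lemma pd_eq_dirD (i : Fin n) (F : (Fin n → ℂ) → ℂ) : pd i F = dirD (Pi.single i 1) F := rfl

lemma dirD_add (hU : IsOpen U) {f g : (Fin n → ℂ) → ℂ}
    (hf : DifferentiableOn ℂ f U) (hg : DifferentiableOn ℂ g U) (v : Fin n → ℂ) :
    EqOn (dirD v (f + g)) (dirD v f + dirD v g) U := by
  intro z hz
  simp only [dirD, Pi.add_apply]
  rw [fderiv_add ((hf z hz).differentiableAt (hU.mem_nhds hz))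
    ((hg z hz).differentiableAt (hU.mem_nhds hz))]
  rfl

lemma dirD_const_smul (hU : IsOpen U) {f : (Fin n → ℂ) → ℂ}
    (hf : DifferentiableOn ℂ f U) (c : ℂ) (v : Fin n → ℂ) :
    EqOn (dirD v (c • f)) (c • dirD v f) U := by
  intro z hz
  simp only [dirD, Pi.smul_apply]
  rw [fderiv_const_smul ((hf z hz).differentiableAt (hU.mem_nhds hz))]
  rfl

lemma dirD_dirD_add (hU : IsOpen U) {f g : (Fin n → ℂ) → ℂ}
    (hf : DifferentiableOn ℂ f U) (hg : DifferentiableOn ℂ g U) (v : Fin n → ℂ) :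
    EqOn (dirD v (dirD v (f + g))) (dirD v (dirD v f) + dirD v (dirD v g)) U :=
  (dirD_congr hU (dirD_add hU hf hg v) v).trans
    (dirD_add hU (differentiableOn_dirD hU hf v) (differentiableOn_dirD hU hg v) v)

variable [NeZero n]

lemma continuous_lor : Continuous (lor : (Fin n → ℝ) → ℝ) := by
  unfold lor; fun_prop

lemma isOpen_cone : IsOpen (cone n) :=
  (isOpen_lt continuous_const continuous_lor).inter
    (isOpen_lt continuous_const (continuous_apply 0))

lemma isOpen_tube : IsOpen (tube n) := isOpen_cone.preimage continuous_imP

lemma box_congr (hU : IsOpen U) {f g : (Fin n → ℂ) → ℂ} (h : EqOn f g U) :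
    EqOn (BoxOp f) (BoxOp g) U := by
  intro z hz
  have := fun i : Fin n => dirD_congr hU (dirD_congr hU h (Pi.single i 1)) (Pi.single i 1) hz
  simp only [BoxOp, pd_eq_dirD, this]

lemma box_iterate_congr (hU : IsOpen U) {f g : (Fin n → ℂ) → ℂ} (h : EqOn f g U) (k : ℕ) :
    EqOn (BoxOp^[k] f) (BoxOp^[k] g) U := by
  induction k with
  | zero => exact h
  | succ k ih => simpa only [Function.iterate_succ_apply'] using box_congr hU ih

lemma differentiableOn_box (hU : IsOpen U) {f : (Fin n → ℂ) → ℂ}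
    (hf : DifferentiableOn ℂ f U) : DifferentiableOn ℂ (BoxOp f) U := by
  have h := fun i : Fin n => differentiableOn_dirD hU
    (differentiableOn_dirD hU hf (Pi.single i 1)) (Pi.single i 1)
  have : BoxOp f = fun z => -(2 * dirD (Pi.single 0 1) (dirD (Pi.single 0 1) f) z -
      ∑ i, dirD (Pi.single i 1) (dirD (Pi.single i 1) f) z) := rfl
  rw [this]
  exact (((h 0).const_mul 2).sub (DifferentiableOn.fun_sum fun i _ => h i)).neg

lemma differentiableOn_box_iterate (hU : IsOpen U) {f : (Fin n → ℂ) → ℂ}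
    (hf : DifferentiableOn ℂ f U) (k : ℕ) : DifferentiableOn ℂ (BoxOp^[k] f) U := by
  induction k with
  | zero => exact hf
  | succ k ih => simpa only [Function.iterate_succ_apply'] using differentiableOn_box hU ih

lemma box_add (hU : IsOpen U) {f g : (Fin n → ℂ) → ℂ} (hf : DifferentiableOn ℂ f U)
    (hg : DifferentiableOn ℂ g U) : EqOn (BoxOp (f + g)) (BoxOp f + BoxOp g) U := by
  intro z hz
  have h := fun i : Fin n => dirD_dirD_add hU hf hg (Pi.single i 1) hz
  simp only [BoxOp, pd_eq_dirD, Pi.add_apply, h, Finset.sum_add_distrib]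
  ring

lemma box_const_smul (hU : IsOpen U) {f : (Fin n → ℂ) → ℂ} (hf : DifferentiableOn ℂ f U)
    (c : ℂ) : EqOn (BoxOp (c • f)) (c • BoxOp f) U := by
  intro z hz
  have h := fun i : Fin n => ((dirD_congr hU (dirD_const_smul hU hf c (Pi.single i 1))
    (Pi.single i 1)).trans (dirD_const_smul hU (differentiableOn_dirD hU hf _) c
      (Pi.single i 1))) hz
  simp only [BoxOp, pd_eq_dirD, Pi.smul_apply, h, smul_eq_mul, ← Finset.mul_sum]
  ring

lemma box_iterate_add (hU : IsOpen U) {f g : (Fin n → ℂ) → ℂ} (hf : DifferentiableOn ℂ f U)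
    (hg : DifferentiableOn ℂ g U) (k : ℕ) :
    EqOn (BoxOp^[k] (f + g)) (BoxOp^[k] f + BoxOp^[k] g) U := by
  induction k with
  | zero => exact fun _ _ => rfl
  | succ k ih =>
    simp only [Function.iterate_succ_apply']
    exact (box_congr hU ih).trans (box_add hU (differentiableOn_box_iterate hU hf k)
      (differentiableOn_box_iterate hU hg k))

lemma box_iterate_const_smul (hU : IsOpen U) {f : (Fin n → ℂ) → ℂ}
    (hf : DifferentiableOn ℂ f U) (c : ℂ) (k : ℕ) :
    EqOn (BoxOp^[k] (c • f)) (c • BoxOp^[k] f) U := by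
  induction k with
  | zero => exact fun _ _ => rfl
  | succ k ih =>
    simp only [Function.iterate_succ_apply']
    exact (box_congr hU ih).trans
      (box_const_smul hU (differentiableOn_box_iterate hU hf k) c)

lemma dirD_box (hU : IsOpen U) {f : (Fin n → ℂ) → ℂ} (hf : DifferentiableOn ℂ f U)
    (v : Fin n → ℂ) : EqOn (dirD v (BoxOp f)) (BoxOp (dirD v f)) U := by
  intro z hz
  have hd := fun i : Fin n => differentiableOn_dirD hU
    (differentiableOn_dirD hU hf (Pi.single i 1)) (Pi.single i 1)
  have hdz := fun i : Fin n => (hd i z hz).differentiableAt (hU.mem_nhds hz)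
  have h1 : ∀ i : Fin n, dirD (Pi.single i 1) (dirD (Pi.single i 1) (dirD v f)) z =
      dirD v (dirD (Pi.single i 1) (dirD (Pi.single i 1) f)) z := by
    intro i
    rw [dirD_congr hU (fun w hw => dirD_comm hU hf (Pi.single i 1) v hw) (Pi.single i 1) hz]
    exact dirD_comm hU (differentiableOn_dirD hU hf _) _ _ hz
  have h2 : HasFDerivAt (BoxOp f) (-((2 : ℂ) • fderiv ℂ (dirD (Pi.single 0 1)
      (dirD (Pi.single 0 1) f)) z - ∑ i, fderiv ℂ (dirD (Pi.single i 1)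
      (dirD (Pi.single i 1) f)) z)) z :=
    (((hdz 0).hasFDerivAt.const_mul 2).sub
      (HasFDerivAt.fun_sum fun i _ => (hdz i).hasFDerivAt)).neg
  have h3 : dirD v (BoxOp f) z = -(2 * dirD v (dirD (Pi.single 0 1) (dirD (Pi.single 0 1) f)) z -
      ∑ i, dirD v (dirD (Pi.single i 1) (dirD (Pi.single i 1) f)) z) := by
    simp only [dirD] at h2 ⊢
    rw [h2.fderiv]
    simp
  rw [h3]
  simp only [BoxOp, pd_eq_dirD, h1]

lemma dirD_iterate_box (hU : IsOpen U) {f : (Fin n → ℂ) → ℂ} (hf : DifferentiableOn ℂ f U)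
    (v : Fin n → ℂ) (j : ℕ) :
    DifferentiableOn ℂ ((dirD v)^[j] f) U ∧
      EqOn ((dirD v)^[j] (BoxOp f)) (BoxOp ((dirD v)^[j] f)) U := by
  induction j with
  | zero => exact ⟨hf, fun _ _ => rfl⟩
  | succ j ih =>
    simp only [Function.iterate_succ_apply']
    exact ⟨differentiableOn_dirD hU ih.1 v, (dirD_congr hU ih.2 v).trans (dirD_box hU ih.1 v)⟩

lemma box_integral {X : Type*} [MeasurableSpace X] {μ : Measure X} {F : (Fin n → ℂ) → X → ℂ}
    (hU : IsOpen U) (h : HolFamily U μ F) :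
    EqOn (BoxOp (fun z => ∫ x, F z x ∂μ)) (fun z => ∫ x, BoxOp (fun z => F z x) z ∂μ) U := by
  intro z hz
  have h1 : ∀ i : Fin n, dirD (Pi.single i 1) (dirD (Pi.single i 1) fun z => ∫ x, F z x ∂μ) z =
      ∫ x, dirD (Pi.single i 1) (dirD (Pi.single i 1) fun z => F z x) z ∂μ := fun i => by
    rw [dirD_congr hU (h.dirD_integral hU (Pi.single i 1)) (Pi.single i 1) hz,
      (h.dirD hU (Pi.single i 1)).dirD_integral hU (Pi.single i 1) hz]
  have h2 : ∀ i : Fin n, Integrable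
      (fun x => dirD (Pi.single i 1) (dirD (Pi.single i 1) fun z => F z x) z) μ := fun i =>
    ((h.dirD hU (Pi.single i 1)).dirD hU (Pi.single i 1)).integrable hz
  simp only [BoxOp, pd_eq_dirD, h1]
  rw [integral_neg, integral_sub ((h2 0).const_mul 2) (integrable_finsetSum _ fun i _ => h2 i),
    integral_const_mul, integral_finsetSum _ fun i _ => h2 i]

end Wave

/-! ### Null coordinates on the light cone -/

section NullCoordinates

variable {d : ℕ}

/-- The vector with null coordinates `a = y₀ + y₁`, `b = y₀ - y₁` and transversal part `t`. -/
def nul {𝕜 : Type*} [Field 𝕜] (a b : 𝕜) (t : Fin d → 𝕜) : Fin (d + 2) → 𝕜 :=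
  Matrix.vecCons ((a + b) / 2) (Matrix.vecCons ((a - b) / 2) t)

@[simp] lemma nul_zero {𝕜 : Type*} [Field 𝕜] (a b : 𝕜) (t : Fin d → 𝕜) :
    nul a b t 0 = (a + b) / 2 := rfl

@[simp] lemma nul_one {𝕜 : Type*} [Field 𝕜] (a b : 𝕜) (t : Fin d → 𝕜) :
    nul a b t 1 = (a - b) / 2 := rfl

@[simp] lemma nul_succ {𝕜 : Type*} [Field 𝕜] (a b : 𝕜) (t : Fin d → 𝕜) (j : Fin d) :
    nul a b t j.succ.succ = t j := rfl

lemma ext_fin_add_two {α : Type*} {f g : Fin (d + 2) → α} (h0 : f 0 = g 0) (h1 : f 1 = g 1)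
    (h : ∀ j : Fin d, f j.succ.succ = g j.succ.succ) : f = g := by
  funext i
  refine Fin.cases h0 (fun i => ?_) i
  exact Fin.cases h1 h i

/-- The first null coordinate. -/
def nA (y : Fin (d + 2) → ℝ) : ℝ := y 0 + y 1

/-- The quotient of the Lorentz form by the first null coordinate. -/
def tau (y : Fin (d + 2) → ℝ) : ℝ := y 0 - y 1 - ∑ j : Fin d, y j.succ.succ ^ 2 / nA y

lemma lor_eq (y : Fin (d + 2) → ℝ) :
    lor y = (y 0 + y 1) * (y 0 - y 1) - ∑ j : Fin d, y j.succ.succ ^ 2 := by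
  rw [lor, Fin.sum_univ_succ, Fin.sum_univ_succ]
  simp only [Fin.succ_zero_eq_one]
  ring

lemma lor_eq_mul {y : Fin (d + 2) → ℝ} (h : nA y ≠ 0) : lor y = nA y * tau y := by
  rw [lor_eq, tau, mul_sub (nA y), Finset.mul_sum, nA]
  congr 1
  refine Finset.sum_congr rfl fun j _ => ?_
  rw [nA] at h
  field_simp

lemma mem_cone_iff {y : Fin (d + 2) → ℝ} : y ∈ cone (d + 2) ↔ 0 < nA y ∧ 0 < tau y := by
  constructor
  · rintro ⟨h, h0⟩
    have hs : 0 ≤ ∑ j : Fin d, y j.succ.succ ^ 2 := by positivity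
    have h1 : 0 < nA y := by
      rw [lor_eq] at h
      by_contra hA
      rw [nA] at hA
      nlinarith
    refine ⟨h1, ?_⟩
    rw [lor_eq_mul h1.ne'] at h
    exact (mul_pos_iff_of_pos_left h1).1 h
  · rintro ⟨h1, h2⟩
    refine ⟨by rw [lor_eq_mul h1.ne']; positivity, ?_⟩
    have hs : 0 ≤ ∑ j : Fin d, y j.succ.succ ^ 2 / nA y := by positivity
    simp only [tau, nA] at *
    linarith

lemma nA_add (y v : Fin (d + 2) → ℝ) : nA (y + v) = nA y + nA v := by
  simp only [nA, Pi.add_apply]; ring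

lemma tau_add {y v : Fin (d + 2) → ℝ} (hy : 0 < nA y) (hv : 0 < nA v) :
    tau y + tau v ≤ tau (y + v) := by
  have h : ∑ j : Fin d, (y + v) j.succ.succ ^ 2 / nA (y + v) ≤
      ∑ j : Fin d, (y j.succ.succ ^ 2 / nA y + v j.succ.succ ^ 2 / nA v) := by
    refine Finset.sum_le_sum fun j _ => ?_
    rw [nA_add, Pi.add_apply, div_add_div _ _ hy.ne' hv.ne',
      div_le_div_iff₀ (by positivity) (by positivity)]
    nlinarith [sq_nonneg (y j.succ.succ * nA v - nA y * v j.succ.succ), mul_pos hy hv]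
  rw [Finset.sum_add_distrib] at h
  simp only [tau, Pi.add_apply] at *
  linarith

lemma add_mem_cone {y v : Fin (d + 2) → ℝ} (hy : y ∈ cone (d + 2)) (hv : v ∈ cone (d + 2)) :
    y + v ∈ cone (d + 2) := by
  rw [mem_cone_iff] at *
  have := tau_add hy.1 hv.1
  rw [nA_add]
  exact ⟨by linarith [hy.1, hv.1], by linarith [hy.2, hv.2]⟩

/-- The parametrization of the closed light cone used to integrate along it. -/
def coneMap (α : ℝ) (w : Fin d ⊕ Fin d → ℝ) : Fin (d + 2) → ℝ :=
  nul (α ^ 2) (∑ i, w i ^ 2) fun j => α * w (Sum.inl j)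

lemma continuous_nul {X : Type*} [TopologicalSpace X] {a b : X → ℝ} {t : X → Fin d → ℝ}
    (ha : Continuous a) (hb : Continuous b) (ht : Continuous t) :
    Continuous fun x => nul (a x) (b x) (t x) := by
  refine continuous_pi fun i => ?_
  refine Fin.cases ?_ (fun i => ?_) i
  · simp only [nul_zero]; fun_prop
  · refine Fin.cases ?_ (fun j => ?_) i
    · simp only [Fin.succ_zero_eq_one, nul_one]; fun_prop
    · simp only [nul_succ]; fun_prop

lemma continuous_coneMap :
    Continuous fun p : ℝ × (Fin d ⊕ Fin d → ℝ) => coneMap p.1 p.2 :=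
  continuous_nul (by fun_prop) (by fun_prop) (by fun_prop)

lemma nA_coneMap (α : ℝ) (w : Fin d ⊕ Fin d → ℝ) : nA (coneMap α w) = α ^ 2 := by
  simp only [nA, coneMap, nul_zero, nul_one]; ring

lemma nA_add_coneMap (y : Fin (d + 2) → ℝ) (α : ℝ) (w : Fin d ⊕ Fin d → ℝ) :
    nA (y + coneMap α w) = nA y + α ^ 2 := by
  rw [nA_add, nA_coneMap]

lemma tau_add_coneMap {y : Fin (d + 2) → ℝ} (hy : 0 < nA y) (α : ℝ)
    (w : Fin d ⊕ Fin d → ℝ) :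
    tau (y + coneMap α w) = tau y + ∑ j, w (Sum.inr j) ^ 2 +
      ∑ j, nA y / (nA y + α ^ 2) * (w (Sum.inl j) - α * y j.succ.succ / nA y) ^ 2 := by
  have hA : 0 < nA y + α ^ 2 := by positivity
  have h : ∀ j : Fin d, nA y / (nA y + α ^ 2) * (w (Sum.inl j) - α * y j.succ.succ / nA y) ^ 2 =
      w (Sum.inl j) ^ 2 - (y j.succ.succ + α * w (Sum.inl j)) ^ 2 / (nA y + α ^ 2) +
        y j.succ.succ ^ 2 / nA y := by
    intro j
    field_simp
    ring
  rw [tau, nA_add_coneMap]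
  simp only [h, tau, Finset.sum_add_distrib, Finset.sum_sub_distrib, Pi.add_apply, coneMap,
    nul_zero, nul_one, nul_succ, Fintype.sum_sum_type]
  ring

lemma tau_le_tau_add_coneMap {y : Fin (d + 2) → ℝ} (hy : 0 < nA y) (α : ℝ)
    (w : Fin d ⊕ Fin d → ℝ) : tau y ≤ tau (y + coneMap α w) := by
  rw [tau_add_coneMap hy]
  have : 0 < nA y + α ^ 2 := by positivity
  have h1 : 0 ≤ ∑ j, w (Sum.inr j) ^ 2 := by positivity
  have h2 : 0 ≤ ∑ j, nA y / (nA y + α ^ 2) *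
      (w (Sum.inl j) - α * y j.succ.succ / nA y) ^ 2 := by positivity
  linarith

lemma add_coneMap_mem_cone {y : Fin (d + 2) → ℝ} (hy : y ∈ cone (d + 2)) (α : ℝ)
    (w : Fin d ⊕ Fin d → ℝ) : y + coneMap α w ∈ cone (d + 2) := by
  rw [mem_cone_iff] at *
  refine ⟨?_, hy.2.trans_le (tau_le_tau_add_coneMap hy.1 α w)⟩
  rw [nA_add_coneMap]
  nlinarith [hy.1, sq_nonneg α]

/-- Multiplication of a real vector by the imaginary unit. -/
def imV {n : ℕ} (y : Fin n → ℝ) : Fin n → ℂ := fun i => I * (y i : ℂ)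

lemma continuous_imV {n : ℕ} : Continuous (imV : (Fin n → ℝ) → Fin n → ℂ) := by
  unfold imV; fun_prop

@[simp] lemma imP_add_imV {n : ℕ} (z : Fin n → ℂ) (y : Fin n → ℝ) :
    imP (z + imV y) = imP z + y := by
  funext i
  simp [imP, imV]

lemma mem_tube {n : ℕ} [NeZero n] {z : Fin n → ℂ} : z ∈ tube n ↔ imP z ∈ cone n := Iff.rfl

/-- The second derivative at a point as a bilinear form. -/
lemma exists_bilin {n : ℕ} {U : Set (Fin n → ℂ)} (hU : IsOpen U) {f : (Fin n → ℂ) → ℂ}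
    (hf : DifferentiableOn ℂ f U) {z : Fin n → ℂ} (hz : z ∈ U) :
    ∃ B : (Fin n → ℂ) →ₗ[ℂ] (Fin n → ℂ) →ₗ[ℂ] ℂ,
      (∀ v w, B v w = dirD v (dirD w f) z) ∧ ∀ v w, B v w = B w v := by
  have h1 : ∀ v w w', dirD v (dirD (w + w') f) z =
      dirD v (dirD w f) z + dirD v (dirD w' f) z := by
    intro v w w'
    have : dirD (w + w') f = dirD w f + dirD w' f := by
      funext x; simp [dirD]
    rw [this]
    exact dirD_add hU (differentiableOn_dirD hU hf w) (differentiableOn_dirD hU hf w') v hz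
  have h2 : ∀ v (c : ℂ) w, dirD v (dirD (c • w) f) z = c * dirD v (dirD w f) z := by
    intro v c w
    have : dirD (c • w) f = c • dirD w f := by
      funext x; simp [dirD]
    rw [this]
    exact dirD_const_smul hU (differentiableOn_dirD hU hf w) c v hz
  refine ⟨LinearMap.mk₂ ℂ (fun v w => dirD v (dirD w f) z) ?_ ?_ h1 fun c v w => h2 v c w,
    fun v w => rfl,
    fun v w => dirD_comm hU hf v w hz⟩
  · intro v v' w; simp [dirD]
  · intro c v w; simp [dirD]

lemma nul_eq (a b : ℂ) (t : Fin d → ℂ) : nul a b t =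
    a • nul 1 0 0 + b • nul 0 1 0 + ∑ j, t j • nul 0 0 (Pi.single j 1) := by
  refine ext_fin_add_two ?_ ?_ fun j => ?_
  · simp [Finset.sum_apply]; ring
  · simp [Finset.sum_apply]; ring
  · simp [Finset.sum_apply, Pi.single_apply]

/-- The wave operator in a null frame adapted to a point with transversal slopes `t`. -/
lemma box_eq_frame {U : Set (Fin (d + 2) → ℂ)} (hU : IsOpen U) {f : (Fin (d + 2) → ℂ) → ℂ}
    (hf : DifferentiableOn ℂ f U) {z : Fin (d + 2) → ℂ} (hz : z ∈ U) (t : Fin d → ℂ) :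
    BoxOp f z = -(4 * dirD (nul 1 (∑ j, t j ^ 2) t) (dirD (nul 0 1 0) f) z -
      ∑ j, dirD (nul 0 (2 * t j) (Pi.single j 1))
        (dirD (nul 0 (2 * t j) (Pi.single j 1)) f) z) := by
  obtain ⟨B, hB, hs⟩ := exists_bilin hU hf hz
  have e0 : (Pi.single 0 1 : Fin (d + 2) → ℂ) = nul 1 0 0 + nul 0 1 0 := by
    refine ext_fin_add_two ?_ ?_ fun j => ?_
    · simp; norm_num
    · simp; norm_num
    · simp [Fin.succ_ne_zero]
  have e1 : (Pi.single 1 1 : Fin (d + 2) → ℂ) = nul 1 0 0 - nul 0 1 0 := by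
    refine ext_fin_add_two ?_ ?_ fun j => ?_
    · simp
    · simp; norm_num
    · have : (j.succ.succ : Fin (d + 2)) ≠ 1 := by
        rw [← Fin.succ_zero_eq_one]; exact fun h => Fin.succ_ne_zero _ (Fin.succ_injective _ h)
      simp [this]
  have ej : ∀ j : Fin d, (Pi.single j.succ.succ 1 : Fin (d + 2) → ℂ) =
      nul 0 0 (Pi.single j 1) := by
    intro j
    refine ext_fin_add_two ?_ ?_ fun i => ?_
    · simp [(Fin.succ_ne_zero _).symm]
    · have : (1 : Fin (d + 2)) ≠ j.succ.succ := by
        rw [← Fin.succ_zero_eq_one]; exact fun h => Fin.succ_ne_zero _ (Fin.succ_injective _ h).symm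
      simp [this]
    · simp [Pi.single_apply, Fin.succ_inj]
  have hj : ∀ j : Fin d, nul 0 (2 * t j) (Pi.single j 1) =
      (2 * t j) • (nul 0 1 0 : Fin (d + 2) → ℂ) + nul 0 0 (Pi.single j 1) := by
    intro j
    refine ext_fin_add_two ?_ ?_ fun i => ?_ <;> simp <;> ring
  have hbox : BoxOp f z = -(2 * B (Pi.single 0 1) (Pi.single 0 1) -
      ∑ i, B (Pi.single i 1) (Pi.single i 1)) := by
    simp only [BoxOp, pd_eq_dirD, hB]
  rw [hbox, Fin.sum_univ_succ, Fin.sum_univ_succ]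
  simp only [Fin.succ_zero_eq_one, ← hB, ej, e0, e1, hj, nul_eq 1 _ t]
  simp only [map_add, map_sub, map_smul, LinearMap.add_apply, LinearMap.sub_apply,
    LinearMap.smul_apply, map_sum, LinearMap.sum_apply, smul_eq_mul, Finset.sum_add_distrib,
    one_mul]
  have hsj : ∀ j : Fin d, B (nul 0 1 0) (nul 0 0 (Pi.single j 1)) =
    B (nul 0 0 (Pi.single j 1)) (nul 0 1 0) := fun j => hs _ _
  simp only [hsj, hs (nul 0 1 0) (nul 1 0 0)]
  simp only [mul_add, Finset.sum_add_distrib, Finset.mul_sum, Finset.sum_mul]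
  have c1 : ∑ i : Fin d, 4 * (t i ^ 2 * B (nul 0 1 0) (nul 0 1 0)) =
      ∑ i, 2 * t i * (2 * t i * B (nul 0 1 0) (nul 0 1 0)) :=
    Finset.sum_congr rfl fun i _ => by ring
  have c2 : ∑ i : Fin d, 4 * (t i * B (nul 0 0 (Pi.single i 1)) (nul 0 1 0)) =
      ∑ i, 2 * t i * B (nul 0 0 (Pi.single i 1)) (nul 0 1 0) +
        ∑ i, 2 * t i * B (nul 0 0 (Pi.single i 1)) (nul 0 1 0) := by
    rw [← Finset.sum_add_distrib]
    exact Finset.sum_congr rfl fun i _ => by ring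
  rw [c1, c2]
  ring

end NullCoordinates

/-! ### Cauchy estimates adapted to the light cone -/

section CauchyEstimates

variable {d : ℕ}

/-- The growth condition `|f| ≤ M / (a^k τ^l)` on the tube, where `a = nA (Im z)` and
`τ = tau (Im z)`. -/
def Growth (k l : ℕ) (M : ℝ) (f : (Fin (d + 2) → ℂ) → ℂ) : Prop :=
  ∀ z ∈ tube (d + 2), ‖f z‖ ≤ M / (nA (imP z) ^ k * tau (imP z) ^ l)

lemma imP_add_smul {n : ℕ} (z : Fin n → ℂ) (ζ : ℂ) (v : Fin n → ℝ) :
    imP (z + ζ • fun i => (v i : ℂ)) = imP z + ζ.im • v := by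
  funext i
  simp [imP]

lemma ofReal_nul (a b : ℝ) (t : Fin d → ℝ) :
    (fun i => ((nul a b t i : ℝ) : ℂ)) = nul (a : ℂ) b fun j => (t j : ℂ) := by
  refine ext_fin_add_two ?_ ?_ fun j => ?_ <;> simp

lemma nA_add_smul_nul (y : Fin (d + 2) → ℝ) (s a b : ℝ) (t : Fin d → ℝ) :
    nA (y + s • nul a b t) = nA y + s * a := by
  simp [nA]; ring

lemma tau_add_smul_nul_time (y : Fin (d + 2) → ℝ) (s : ℝ) :
    tau (y + s • nul 0 1 0) = tau y + s := by
  simp only [tau, nA_add_smul_nul]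
  simp
  ring

lemma tau_add_smul_nul_long {y : Fin (d + 2) → ℝ} {s : ℝ} (h : nA y ≠ 0) (hs : nA y + s ≠ 0) :
    tau (y + s • nul 1 (∑ j : Fin d, (y j.succ.succ / nA y) ^ 2)
      fun j => y j.succ.succ / nA y) = tau y := by
  have h1 : ∀ j : Fin d, (y j.succ.succ + s * (y j.succ.succ / nA y)) ^ 2 / (nA y + s * 1) =
      y j.succ.succ ^ 2 / nA y + s * (y j.succ.succ / nA y) ^ 2 := by
    intro j
    rw [mul_one]
    field_simp
  simp only [tau, nA_add_smul_nul]
  simp only [Pi.add_apply, Pi.smul_apply, nul_zero, nul_one, nul_succ, smul_eq_mul, h1,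
    Finset.sum_add_distrib, ← Finset.mul_sum]
  ring

lemma tau_add_smul_nul_trans {y : Fin (d + 2) → ℝ} (s : ℝ) (h : nA y ≠ 0) (j : Fin d) :
    tau (y + s • nul 0 (2 * (y j.succ.succ / nA y)) (Pi.single j 1)) = tau y - s ^ 2 / nA y := by
  have h1 : ∀ i : Fin d, (y i.succ.succ + s * (Pi.single j 1 : Fin d → ℝ) i) ^ 2 / nA y =
      y i.succ.succ ^ 2 / nA y +
        (if i = j then 2 * s * (y j.succ.succ / nA y) + s ^ 2 / nA y else 0) := by
    intro i
    split_ifs with hij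
    · subst hij
      simp
      field_simp
      ring
    · simp [hij]
  simp only [tau, nA_add_smul_nul, mul_zero, add_zero]
  simp only [Pi.add_apply, Pi.smul_apply, nul_zero, nul_one, nul_succ, smul_eq_mul, h1,
    Finset.sum_add_distrib, Finset.sum_ite_eq', Finset.mem_univ, if_true]
  ring

lemma Growth.nonneg {k l : ℕ} {M : ℝ} {f : (Fin (d + 2) → ℂ) → ℂ} (h : Growth k l M f) :
    0 ≤ M := by
  have hz : imV (nul 1 1 0) ∈ tube (d + 2) := by
    rw [mem_tube, mem_cone_iff]
    simp [nA, tau, imP, imV]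
  have h1 := (norm_nonneg _).trans (h _ hz)
  rw [mem_tube, mem_cone_iff] at hz
  by_contra hM
  have : M / (nA (imP (imV (nul 1 1 0) : Fin (d + 2) → ℂ)) ^ k *
      tau (imP (imV (nul 1 1 0) : Fin (d + 2) → ℂ)) ^ l) < 0 :=
    div_neg_of_neg_of_pos (not_le.1 hM) (mul_pos (pow_pos hz.1 _) (pow_pos hz.2 _))
  linarith

lemma Growth.le_of_le {k l : ℕ} {M a t : ℝ} {f : (Fin (d + 2) → ℂ) → ℂ} (h : Growth k l M f)
    {z : Fin (d + 2) → ℂ} (ha : 0 < a) (ht : 0 < t) (hza : a ≤ nA (imP z))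
    (hzt : t ≤ tau (imP z)) : ‖f z‖ ≤ M / (a ^ k * t ^ l) := by
  have hM := h.nonneg
  have hz := ha.trans_le hza
  refine (h z ((mem_tube.trans mem_cone_iff).2 ⟨hz, ht.trans_le hzt⟩)).trans ?_
  gcongr

lemma Growth.mono {k l : ℕ} {M M' : ℝ} {f : (Fin (d + 2) → ℂ) → ℂ} (h : Growth k l M f)
    (hM : M ≤ M') : Growth k l M' f := by
  intro z hz
  refine (h z hz).trans ?_
  rw [mem_tube, mem_cone_iff] at hz
  have := mul_pos (pow_pos hz.1 k) (pow_pos hz.2 l)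
  gcongr

/-- The derivative in the null direction transversal to the first null coordinate. -/
def dirB (f : (Fin (d + 2) → ℂ) → ℂ) : (Fin (d + 2) → ℂ) → ℂ := dirD (nul 0 1 0) f

lemma nul_time_eq : (nul 0 1 0 : Fin (d + 2) → ℂ) = fun i => ((nul 0 1 0 i : ℝ) : ℂ) := by
  rw [ofReal_nul]
  simp
  rfl

lemma Growth.dirB {k l : ℕ} {M : ℝ} {f : (Fin (d + 2) → ℂ) → ℂ}
    (hf : DifferentiableOn ℂ f (tube (d + 2))) (h : Growth k l M f) :
    Growth k (l + 1) (M * 2 ^ (l + 1)) (_root_.dirB f) := by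
  intro z hz
  obtain ⟨ha, ht⟩ := mem_cone_iff.1 hz
  have key : ‖_root_.dirB f z‖ ≤ M / (nA (imP z) ^ k * (tau (imP z) / 2) ^ l) /
      (tau (imP z) / 2) := by
    refine norm_dirD_le isOpen_tube hf (by positivity) fun ζ hζ => ?_
    have him := (Complex.abs_im_le_norm ζ).trans hζ
    rw [abs_le] at him
    have h1 : nA (imP (z + ζ • nul 0 1 0)) = nA (imP z) := by
      rw [nul_time_eq, imP_add_smul, nA_add_smul_nul]; simp
    have h2 : tau (imP (z + ζ • nul 0 1 0)) = tau (imP z) + ζ.im := by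
      rw [nul_time_eq, imP_add_smul, tau_add_smul_nul_time]
    refine ⟨(mem_tube.trans mem_cone_iff).2 ⟨h1 ▸ ha, by linarith⟩, ?_⟩
    exact h.le_of_le ha (by positivity) h1.ge (by linarith)
  refine key.trans (le_of_eq ?_)
  rw [div_pow]
  field_simp
  ring

lemma Growth.dirB_iterate (k l j : ℕ) : ∃ C : ℝ, ∀ (M : ℝ) (f : (Fin (d + 2) → ℂ) → ℂ),
    DifferentiableOn ℂ f (tube (d + 2)) → Growth k l M f →
      Growth k (l + j) (C * M) (_root_.dirB^[j] f) := by
  induction j with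
  | zero => exact ⟨1, fun M f _ h => by simpa using h⟩
  | succ j ih =>
    obtain ⟨C, hC⟩ := ih
    refine ⟨C * 2 ^ (l + j + 1), fun M f hf h => ?_⟩
    rw [Function.iterate_succ_apply']
    exact ((hC M f hf h).dirB (dirD_iterate_box isOpen_tube hf _ j).1).mono
      (le_of_eq (by ring))

/-- Cauchy's estimate for the wave operator. -/
lemma Growth.box {k : ℕ} {M : ℝ} {f : (Fin (d + 2) → ℂ) → ℂ}
    (hf : DifferentiableOn ℂ f (tube (d + 2))) (h : Growth k k M f) :
    Growth (k + 1) (k + 1) ((16 + 16 * d) * 4 ^ k * M) (BoxOp f) := by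
  intro z hz
  obtain ⟨ha, ht⟩ := mem_cone_iff.1 hz
  have hM := h.nonneg
  set y := imP z with hy
  set a := nA y with hadef
  set T := tau y with hT
  rw [box_eq_frame isOpen_tube hf hz fun j : Fin d => ((y j.succ.succ / a : ℝ) : ℂ)]
  have k1 : ‖dirD (nul 1 (∑ j : Fin d, ((y j.succ.succ / a : ℝ) : ℂ) ^ 2)
      fun j : Fin d => ((y j.succ.succ / a : ℝ) : ℂ)) (dirD (nul 0 1 0) f) z‖ ≤
      M / ((a / 2) ^ k * (T / 2) ^ k) / (T / 2) / (a / 2) := by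
    have hu : (nul 1 (∑ j : Fin d, ((y j.succ.succ / a : ℝ) : ℂ) ^ 2)
        fun j : Fin d => ((y j.succ.succ / a : ℝ) : ℂ)) = fun i => ((nul 1 (∑ j : Fin d,
          (y j.succ.succ / a) ^ 2) (fun j => y j.succ.succ / a) i : ℝ) : ℂ) := by
      rw [ofReal_nul]
      push_cast
      rfl
    refine norm_dirD_le isOpen_tube (differentiableOn_dirD isOpen_tube hf _) (by positivity)
      fun ζ hζ => ?_
    have him := (Complex.abs_im_le_norm ζ).trans hζ
    rw [abs_le] at him
    have h1 : nA (imP (z + ζ • nul 1 (∑ j : Fin d, ((y j.succ.succ / a : ℝ) : ℂ) ^ 2)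
        fun j : Fin d => ((y j.succ.succ / a : ℝ) : ℂ))) = a + ζ.im := by
      rw [hu, imP_add_smul, nA_add_smul_nul, mul_one]
    have h2 : tau (imP (z + ζ • nul 1 (∑ j : Fin d, ((y j.succ.succ / a : ℝ) : ℂ) ^ 2)
        fun j : Fin d => ((y j.succ.succ / a : ℝ) : ℂ))) = T := by
      rw [hu, imP_add_smul]
      exact tau_add_smul_nul_long ha.ne' (by linarith)
    set z' := z + ζ • nul 1 (∑ j : Fin d, ((y j.succ.succ / a : ℝ) : ℂ) ^ 2)
        fun j : Fin d => ((y j.succ.succ / a : ℝ) : ℂ)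
    refine ⟨(mem_tube.trans mem_cone_iff).2 ⟨by linarith, h2 ▸ ht⟩, ?_⟩
    refine norm_dirD_le isOpen_tube hf (by positivity) fun ζ' hζ' => ?_
    have him' := (Complex.abs_im_le_norm ζ').trans hζ'
    rw [abs_le] at him'
    have h1' : nA (imP (z' + ζ' • nul 0 1 0)) = a + ζ.im := by
      rw [nul_time_eq, imP_add_smul, nA_add_smul_nul, h1]; simp
    have h2' : tau (imP (z' + ζ' • nul 0 1 0)) = T + ζ'.im := by
      rw [nul_time_eq, imP_add_smul, tau_add_smul_nul_time, h2]
    exact ⟨(mem_tube.trans mem_cone_iff).2 ⟨by linarith, by linarith⟩,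
      h.le_of_le (by positivity) (by positivity) (by linarith) (by linarith)⟩
  have k2 : ∀ j : Fin d, ‖dirD (nul 0 (2 * ((y j.succ.succ / a : ℝ) : ℂ)) (Pi.single j 1))
      (dirD (nul 0 (2 * ((y j.succ.succ / a : ℝ) : ℂ)) (Pi.single j 1)) f) z‖ ≤
      M / ((a / 2) ^ k * (T / 2) ^ k) / (√(a * T) / 4) / (√(a * T) / 4) := by
    intro j
    have hu : (nul 0 (2 * ((y j.succ.succ / a : ℝ) : ℂ)) (Pi.single j 1)) =
        fun i => ((nul 0 (2 * (y j.succ.succ / a)) (Pi.single j 1) i : ℝ) : ℂ) := by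
      rw [ofReal_nul]
      congr 1
      · push_cast; rfl
      · funext i
        rcases eq_or_ne i j with rfl | hij
        · simp
        · simp [hij]
    have hpos : 0 < √(a * T) := Real.sqrt_pos.2 (by positivity)
    have hsq : √(a * T) ^ 2 = a * T := Real.sq_sqrt (by positivity)
    have hmem : ∀ ζ : ℂ, ‖ζ‖ ≤ √(a * T) / 2 →
        T / 2 ≤ T - ζ.im ^ 2 / a := by
      intro ζ hζ
      have him := (Complex.abs_im_le_norm ζ).trans hζ
      have h3 : ζ.im ^ 2 ≤ (√(a * T) / 2) ^ 2 := sq_le_sq' (by linarith [(abs_le.1 him).1])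
        (abs_le.1 him).2
      rw [div_pow, hsq] at h3
      have h4 : ζ.im ^ 2 / a ≤ T / 4 := by
        rw [div_le_iff₀ ha]; linarith
      linarith
    have h1 : ∀ ζ : ℂ, nA (imP (z + ζ • nul 0 (2 * ((y j.succ.succ / a : ℝ) : ℂ))
        (Pi.single j 1))) = a := by
      intro ζ
      rw [hu, imP_add_smul, nA_add_smul_nul]; simp [hadef, hy]
    have h2 : ∀ ζ : ℂ, tau (imP (z + ζ • nul 0 (2 * ((y j.succ.succ / a : ℝ) : ℂ))
        (Pi.single j 1))) = T - ζ.im ^ 2 / a := by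
      intro ζ
      rw [hu, imP_add_smul]
      exact tau_add_smul_nul_trans _ ha.ne' j
    refine norm_dirD_le isOpen_tube (differentiableOn_dirD isOpen_tube hf _) (by positivity)
      fun ζ hζ => ⟨(mem_tube.trans mem_cone_iff).2 ⟨(h1 ζ).symm ▸ ha, ?_⟩, ?_⟩
    · rw [h2]
      linarith [hmem ζ (by linarith)]
    refine norm_dirD_le isOpen_tube hf (by positivity) fun ζ' hζ' => ?_
    have h5 : ‖ζ + ζ'‖ ≤ √(a * T) / 2 := by linarith [norm_add_le ζ ζ']
    rw [add_assoc, ← add_smul]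
    refine ⟨(mem_tube.trans mem_cone_iff).2 ⟨(h1 _).symm ▸ ha, ?_⟩, ?_⟩
    · rw [h2]
      linarith [hmem _ h5]
    · refine h.le_of_le (by positivity) (by positivity) ?_ ((hmem _ h5).trans (h2 _).ge)
      rw [h1]
      linarith
  have e2 : M / ((a / 2) ^ k * (T / 2) ^ k) / (√(a * T) / 4) / (√(a * T) / 4) =
      16 * 4 ^ k * M / (a ^ (k + 1) * T ^ (k + 1)) := by
    rw [div_div _ (√(a * T) / 4), show √(a * T) / 4 * (√(a * T) / 4) = a * T / 16 by
      rw [div_mul_div_comm, Real.mul_self_sqrt (by positivity)]; norm_num]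
    rw [show (4 : ℝ) ^ k = 2 ^ k * 2 ^ k by rw [← mul_pow]; norm_num, div_pow, div_pow]
    field_simp
    ring
  have e1 : M / ((a / 2) ^ k * (T / 2) ^ k) / (T / 2) / (a / 2) =
      4 * 4 ^ k * M / (a ^ (k + 1) * T ^ (k + 1)) := by
    rw [show (4 : ℝ) ^ k = 2 ^ k * 2 ^ k by rw [← mul_pow]; norm_num, div_pow, div_pow]
    field_simp
    ring
  rw [e1] at k1
  simp only [e2] at k2
  rw [norm_neg]
  refine (norm_sub_le _ _).trans ?_
  have k3 := (norm_sum_le _ _).trans (Finset.sum_le_sum fun j (_ : j ∈ Finset.univ) => k2 j)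
  rw [Finset.sum_const, Finset.card_univ, Fintype.card_fin, nsmul_eq_mul] at k3
  rw [norm_mul, Complex.norm_ofNat]
  calc _ ≤ 4 * (4 * 4 ^ k * M / (a ^ (k + 1) * T ^ (k + 1))) +
        d * (16 * 4 ^ k * M / (a ^ (k + 1) * T ^ (k + 1))) := by gcongr
    _ = _ := by ring

end CauchyEstimates

/-! ### Integrals over the boundary of the light cone -/

section ConeIntegrals

lemma lintegral_diagonal_affine {ι : Type*} [Fintype ι] [DecidableEq ι] {D : ι → ℝ}
    (hD : ∀ i, 0 < D i) (b : ι → ℝ) {g : (ι → ℝ) → ℝ≥0∞} (hg : Measurable g) :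
    ∫⁻ w, g w = ENNReal.ofReal (∏ i, D i) * ∫⁻ v : ι → ℝ, g fun i => D i * v i + b i := by
  have hpos : 0 < ∏ i, D i := Finset.prod_pos fun i _ => hD i
  have hdet : (Matrix.diagonal D).det ≠ 0 := by
    rw [Matrix.det_diagonal]; exact hpos.ne'
  have h1 := Real.smul_map_diagonal_volume_pi hdet
  rw [Matrix.det_diagonal, abs_of_pos hpos] at h1
  have h2 : ∫⁻ w, g w = ∫⁻ w, g (w + b) := (lintegral_add_right_eq_self g b).symm
  have hm : Measurable fun w : ι → ℝ => g (w + b) := hg.comp (measurable_add_const b)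
  rw [h2, ← h1, lintegral_smul_measure, lintegral_map hm
    (LinearMap.continuous_of_finiteDimensional _).measurable, smul_eq_mul]
  rw [h1]
  congr 2
  funext v
  congr 1
  funext i
  simp [Matrix.toLin'_apply, Matrix.mulVec_diagonal]

variable {d : ℕ}

/-- The integral of `(1 + |v|²)⁻ˡ` over `ℝ^(2d)`. -/
def bracketInt (d l : ℕ) : ℝ :=
  ∫ v : Fin d ⊕ Fin d → ℝ, ((1 + ∑ i, v i ^ 2) ^ l)⁻¹

lemma continuous_bracket {ι : Type*} [Fintype ι] (l : ℕ) :
    Continuous fun v : ι → ℝ => ((1 + ∑ i, v i ^ 2) ^ l)⁻¹ :=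
  Continuous.inv₀ (by fun_prop) fun v => (by positivity)

lemma norm_sq_le_sum {ι : Type*} [Fintype ι] (v : ι → ℝ) : ‖v‖ ^ 2 ≤ ∑ i, v i ^ 2 := by
  have h : ‖v‖ ≤ √(∑ i, v i ^ 2) := by
    refine (pi_norm_le_iff_of_nonneg (Real.sqrt_nonneg _)).2 fun i => ?_
    refine Real.le_sqrt_of_sq_le ?_
    rw [Real.norm_eq_abs, sq_abs]
    exact Finset.single_le_sum (f := fun i => v i ^ 2) (fun i _ => sq_nonneg _)
      (Finset.mem_univ i)
  calc ‖v‖ ^ 2 ≤ √(∑ i, v i ^ 2) ^ 2 := by gcongr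
    _ = _ := Real.sq_sqrt (by positivity)

lemma integrable_bracket {l : ℕ} (hl : d < l) :
    Integrable fun v : Fin d ⊕ Fin d → ℝ => ((1 + ∑ i, v i ^ 2) ^ l)⁻¹ := by
  have h : Integrable fun v : Fin d ⊕ Fin d → ℝ => (1 + ‖v‖ ^ 2) ^ (-(2 * l : ℝ) / 2) := by
    refine integrable_rpow_neg_one_add_norm_sq ?_
    simp only [Module.finrank_fintype_fun_eq_card, Fintype.card_sum, Fintype.card_fin]
    exact_mod_cast (by omega : d + d < 2 * l)
  refine h.mono' (continuous_bracket l).aestronglyMeasurable (ae_of_all _ fun v => ?_)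
  rw [Real.norm_of_nonneg (by positivity), show -(2 * l : ℝ) / 2 = -(l : ℝ) by ring,
    Real.rpow_neg (by positivity), Real.rpow_natCast]
  have := norm_sq_le_sum v
  gcongr

lemma bracketInt_nonneg (d l : ℕ) : 0 ≤ bracketInt d l :=
  integral_nonneg fun v => by positivity

lemma continuous_nA : Continuous (nA : (Fin (d + 2) → ℝ) → ℝ) := by
  unfold nA; fun_prop

lemma measurable_tau : Measurable (tau : (Fin (d + 2) → ℝ) → ℝ) := by
  unfold tau nA; fun_prop

lemma measurable_coneMap :
    Measurable fun p : ℝ × (Fin d ⊕ Fin d → ℝ) => coneMap p.1 p.2 :=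
  continuous_coneMap.measurable

lemma measurable_coneMap_right (α : ℝ) :
    Measurable fun w : Fin d ⊕ Fin d → ℝ => coneMap α w :=
  measurable_coneMap.comp measurable_prodMk_left

lemma lintegral_tau {l : ℕ} (hl : d < l) {y : Fin (d + 2) → ℝ} (hy : y ∈ cone (d + 2)) (α : ℝ) :
    ∫⁻ w, ENNReal.ofReal (tau (y + coneMap α w) ^ l)⁻¹ =
      ENNReal.ofReal (tau y ^ d * √((nA y + α ^ 2) / nA y) ^ d * (tau y ^ l)⁻¹ *
        bracketInt d l) := by
  obtain ⟨ha, ht⟩ := mem_cone_iff.1 hy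
  have hA : 0 < nA y + α ^ 2 := by positivity
  set D : Fin d ⊕ Fin d → ℝ :=
    Sum.elim (fun _ => √(tau y) * √((nA y + α ^ 2) / nA y)) fun _ => √(tau y)
  set b : Fin d ⊕ Fin d → ℝ := Sum.elim (fun j => α * y j.succ.succ / nA y) fun _ => 0
  have hD : ∀ i, 0 < D i := by
    rintro (i | i) <;> simp only [D, Sum.elim_inl, Sum.elim_inr] <;> positivity
  have hm : Measurable fun w => ENNReal.ofReal (tau (y + coneMap α w) ^ l)⁻¹ :=
    ((measurable_tau.comp
      ((measurable_coneMap_right α).const_add y)).pow_const l).inv.ennreal_ofReal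
  rw [lintegral_diagonal_affine hD b hm]
  have key : ∀ v : Fin d ⊕ Fin d → ℝ,
      tau (y + coneMap α fun i => D i * v i + b i) = tau y * (1 + ∑ i, v i ^ 2) := by
    intro v
    rw [tau_add_coneMap ha, Fintype.sum_sum_type]
    simp only [D, b, Sum.elim_inl, Sum.elim_inr, add_zero, add_sub_cancel_right, mul_pow,
      Real.sq_sqrt ht.le, Real.sq_sqrt (div_nonneg hA.le ha.le)]
    have h1 : ∀ x : ℝ, nA y / (nA y + α ^ 2) * (tau y * ((nA y + α ^ 2) / nA y) * x ^ 2) =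
        tau y * x ^ 2 := by
      intro x; field_simp
    simp only [h1, ← Finset.mul_sum]
    ring
  simp only [key]
  have hprod : ∏ i, D i = tau y ^ d * √((nA y + α ^ 2) / nA y) ^ d := by
    rw [Fintype.prod_sum_type]
    simp only [D, Sum.elim_inl, Sum.elim_inr, Finset.prod_const, Finset.card_univ,
      Fintype.card_fin, mul_pow]
    calc _ = (√(tau y) ^ 2) ^ d * √((nA y + α ^ 2) / nA y) ^ d := by ring
      _ = _ := by rw [Real.sq_sqrt ht.le]
  have h2 : ∀ v : Fin d ⊕ Fin d → ℝ, ENNReal.ofReal ((tau y * (1 + ∑ i, v i ^ 2)) ^ l)⁻¹ =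
      ENNReal.ofReal (tau y ^ l)⁻¹ * ENNReal.ofReal ((1 + ∑ i, v i ^ 2) ^ l)⁻¹ := by
    intro v
    rw [mul_pow, mul_inv, ENNReal.ofReal_mul (by positivity)]
  simp only [h2]
  rw [lintegral_const_mul' _ _ ENNReal.ofReal_ne_top, hprod,
    ← ofReal_integral_eq_lintegral_ofReal (integrable_bracket hl)
      (ae_of_all _ fun v => by positivity), ← bracketInt,
    ← ENNReal.ofReal_mul (by positivity), ← ENNReal.ofReal_mul (by positivity)]
  congr 1
  ring

lemma tau_add_coneMap_pos {y : Fin (d + 2) → ℝ} (hy : y ∈ cone (d + 2)) (α : ℝ)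
    (w : Fin d ⊕ Fin d → ℝ) : 0 < tau (y + coneMap α w) :=
  (mem_cone_iff.1 (add_coneMap_mem_cone hy α w)).2

lemma integrable_tau {l : ℕ} (hl : d < l) {y : Fin (d + 2) → ℝ} (hy : y ∈ cone (d + 2)) (α : ℝ) :
    Integrable (fun w => (tau (y + coneMap α w) ^ l)⁻¹) ∧
    ∫ w, (tau (y + coneMap α w) ^ l)⁻¹ = tau y ^ d * √((nA y + α ^ 2) / nA y) ^ d *
      (tau y ^ l)⁻¹ * bracketInt d l := by
  obtain ⟨ha, ht⟩ := mem_cone_iff.1 hy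
  have hm : Measurable fun w => (tau (y + coneMap α w) ^ l)⁻¹ :=
    ((measurable_tau.comp ((measurable_coneMap_right α).const_add y)).pow_const l).inv
  have hnn : ∀ w, 0 ≤ (tau (y + coneMap α w) ^ l)⁻¹ := fun w =>
    inv_nonneg.2 (pow_nonneg (tau_add_coneMap_pos hy α w).le _)
  have hc := bracketInt_nonneg d l
  constructor
  · refine ⟨hm.aestronglyMeasurable, ?_⟩
    rw [hasFiniteIntegral_iff_ofReal (ae_of_all _ hnn), lintegral_tau hl hy]
    exact ENNReal.ofReal_lt_top
  · rw [integral_eq_lintegral_of_nonneg_ae (ae_of_all _ hnn) hm.aestronglyMeasurable,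
      lintegral_tau hl hy, ENNReal.toReal_ofReal (by positivity)]

lemma lintegral_radial {k : ℕ} (hk : (d : ℝ) / 2 < k) {a : ℝ} (ha : 0 < a) :
    ∫⁻ α in Ioi (0 : ℝ), ENNReal.ofReal (α * ((a + α ^ 2) ^ (k + 1))⁻¹ *
      √((a + α ^ 2) / a) ^ d) = ENNReal.ofReal ((a ^ k)⁻¹ / (2 * k - d)) := by
  have hkd : (0 : ℝ) < 2 * k - d := by linarith
  set p : ℝ := k - d / 2
  have hp : 0 < p := by simp only [p]; linarith
  have hs : ∀ x : ℝ, 0 ≤ x → √x ^ d = x ^ ((d : ℝ) / 2) := by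
    intro x hx
    rw [Real.sqrt_eq_rpow, ← Real.rpow_natCast, ← Real.rpow_mul hx]
    congr 1; ring
  set G : ℝ → ℝ := fun α => -((a + α ^ 2) ^ (-p) * a ^ (-((d : ℝ) / 2)) / (2 * k - d))
  have hder : ∀ α ∈ Ici (0 : ℝ), HasDerivAt G (α * ((a + α ^ 2) ^ (k + 1))⁻¹ *
      √((a + α ^ 2) / a) ^ d) α := by
    intro α _
    have hA : 0 < a + α ^ 2 := by positivity
    have h1 : HasDerivAt (fun α : ℝ => a + α ^ 2) (2 * α) α := by
      simpa using ((hasDerivAt_id α).pow 2).const_add a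
    have h2 := ((((h1.rpow_const (p := -p) (Or.inl hA.ne')).mul_const
      (a ^ (-((d : ℝ) / 2)))).div_const (2 * k - d)).neg)
    refine h2.congr_deriv ?_
    rw [hs _ (by positivity), Real.div_rpow hA.le ha.le, Real.rpow_neg ha.le,
      show -p - 1 = (d : ℝ) / 2 - ((k + 1 : ℕ) : ℝ) by simp only [p]; push_cast; ring,
      Real.rpow_sub hA, Real.rpow_natCast]
    have : p = (2 * k - d) / 2 := by simp only [p]; ring
    rw [this]
    have := Real.rpow_pos_of_pos ha ((d : ℝ) / 2)
    field_simp
  have hnn : ∀ α ∈ Ioi (0 : ℝ), 0 ≤ α * ((a + α ^ 2) ^ (k + 1))⁻¹ *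
      √((a + α ^ 2) / a) ^ d := by
    intro α hα
    have : (0 : ℝ) < α := hα
    positivity
  have hlim : Filter.Tendsto G Filter.atTop (nhds 0) := by
    have h1 : Filter.Tendsto (fun α : ℝ => a + α ^ 2) Filter.atTop Filter.atTop :=
      Filter.tendsto_atTop_add_const_left _ _ (Filter.tendsto_pow_atTop two_ne_zero)
    have h2 := (((tendsto_rpow_neg_atTop hp).comp h1).mul_const
      (a ^ (-((d : ℝ) / 2)))).div_const (2 * k - d : ℝ)
    simpa [G] using h2.neg
  have hInt := integrableOn_Ioi_deriv_of_nonneg' hder hnn hlim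
  rw [← ofReal_integral_eq_lintegral_ofReal hInt
    ((ae_restrict_iff' measurableSet_Ioi).2 (ae_of_all _ hnn)),
    integral_Ioi_of_hasDerivAt_of_nonneg' hder hnn hlim]
  congr 1
  simp only [G]
  rw [show a + 0 ^ 2 = a by ring, ← Real.rpow_add ha,
    show -p + -((d : ℝ) / 2) = -(k : ℝ) by simp only [p]; ring, Real.rpow_neg ha.le,
    Real.rpow_natCast]
  ring

/-- The parameter measure of the cone potential. -/
def coneMeas (d : ℕ) : Measure (ℝ × (Fin d ⊕ Fin d → ℝ)) :=
  (volume.restrict (Ioi 0)).prod volume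

/-- The size of the integrand of the cone potential. -/
def coneWeight (k : ℕ) (y : Fin (d + 2) → ℝ) (p : ℝ × (Fin d ⊕ Fin d → ℝ)) : ℝ :=
  p.1 * (nA (y + coneMap p.1 p.2) ^ (k + 1) * tau (y + coneMap p.1 p.2) ^ (k + d))⁻¹

lemma ae_coneMeas_pos : ∀ᵐ p ∂coneMeas d, 0 < p.1 := by
  have h : ∀ᵐ α ∂(volume.restrict (Ioi (0 : ℝ))), 0 < α := ae_restrict_mem measurableSet_Ioi
  exact Measure.quasiMeasurePreserving_fst.ae h

lemma coneWeight_nonneg (k : ℕ) {y : Fin (d + 2) → ℝ} (hy : y ∈ cone (d + 2))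
    {p : ℝ × (Fin d ⊕ Fin d → ℝ)} (hp : 0 < p.1) : 0 ≤ coneWeight k y p := by
  obtain ⟨h1, h2⟩ := mem_cone_iff.1 (add_coneMap_mem_cone hy p.1 p.2)
  unfold coneWeight
  positivity

lemma measurable_coneWeight (k : ℕ) (y : Fin (d + 2) → ℝ) : Measurable (coneWeight k y) := by
  have h1 : Measurable fun p : ℝ × (Fin d ⊕ Fin d → ℝ) => y + coneMap p.1 p.2 :=
    measurable_coneMap.const_add y
  exact measurable_fst.mul
    (((continuous_nA.measurable.comp h1).pow_const _).mul
      ((measurable_tau.comp h1).pow_const _)).inv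

lemma integrable_coneWeight {k : ℕ} (hk : (d : ℝ) / 2 < k) {y : Fin (d + 2) → ℝ}
    (hy : y ∈ cone (d + 2)) : Integrable (coneWeight k y) (coneMeas d) ∧
      ∫ p, coneWeight k y p ∂coneMeas d =
        bracketInt d (k + d) / (2 * k - d) / (nA y ^ k * tau y ^ k) := by
  obtain ⟨ha, ht⟩ := mem_cone_iff.1 hy
  have hkd : (0 : ℝ) < 2 * k - d := by linarith
  have hk0 : 0 < k := by
    have : (0 : ℝ) < k := lt_of_le_of_lt (by positivity) hk
    exact_mod_cast this
  have hb := bracketInt_nonneg d (k + d)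
  have hnn : 0 ≤ᵐ[coneMeas d] coneWeight k y := by
    filter_upwards [ae_coneMeas_pos] with p hp using coneWeight_nonneg k hy hp
  have hm := measurable_coneWeight k y
  have hin : ∀ α ∈ Ioi (0 : ℝ), ∫⁻ w, ENNReal.ofReal (coneWeight k y (α, w)) =
      ENNReal.ofReal (α * ((nA y + α ^ 2) ^ (k + 1))⁻¹ * √((nA y + α ^ 2) / nA y) ^ d) *
        ENNReal.ofReal ((tau y ^ k)⁻¹ * bracketInt d (k + d)) := by
    intro α hα
    have hα' : (0 : ℝ) < α := hα
    have h1 : ∀ w, ENNReal.ofReal (coneWeight k y (α, w)) =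
        ENNReal.ofReal (α * ((nA y + α ^ 2) ^ (k + 1))⁻¹) *
          ENNReal.ofReal (tau (y + coneMap α w) ^ (k + d))⁻¹ := by
      intro w
      rw [← ENNReal.ofReal_mul (by positivity), coneWeight, nA_add_coneMap, mul_inv, mul_assoc]
    simp only [h1]
    rw [lintegral_const_mul' _ _ ENNReal.ofReal_ne_top, lintegral_tau (by omega) hy,
      ← ENNReal.ofReal_mul (by positivity), ← ENNReal.ofReal_mul (by positivity)]
    congr 1
    rw [pow_add (tau y)]
    field_simp
  have key : ∫⁻ p, ENNReal.ofReal (coneWeight k y p) ∂coneMeas d =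
      ENNReal.ofReal (bracketInt d (k + d) / (2 * k - d) / (nA y ^ k * tau y ^ k)) := by
    rw [coneMeas, lintegral_prod _ hm.ennreal_ofReal.aemeasurable,
      setLIntegral_congr_fun measurableSet_Ioi hin,
      lintegral_mul_const' _ _ ENNReal.ofReal_ne_top, lintegral_radial hk ha,
      ← ENNReal.ofReal_mul (by positivity)]
    congr 1
    field_simp
  constructor
  · refine ⟨hm.aestronglyMeasurable, ?_⟩
    rw [hasFiniteIntegral_iff_ofReal hnn, key]
    exact ENNReal.ofReal_lt_top
  · rw [integral_eq_lintegral_of_nonneg_ae hnn hm.aestronglyMeasurable, key,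
      ENNReal.toReal_ofReal (by positivity)]

end ConeIntegrals

/-! ### The cone potential -/

section ConePotential

lemma dirD_const_mul_translate {n : ℕ} (c : ℂ) (g : (Fin n → ℂ) → ℂ) (s v : Fin n → ℂ) :
    dirD v (fun z => c * g (z + s)) = fun z => c * dirD v g (z + s) := by
  funext z
  have h : (fun z => c * g (z + s)) = c • fun z => g (z + s) := rfl
  rw [dirD, h, fderiv_const_smul_field, Pi.smul_apply, fderiv_comp_add_right]
  rfl

lemma box_const_mul_translate {n : ℕ} [NeZero n] (c : ℂ) (g : (Fin n → ℂ) → ℂ)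
    (s : Fin n → ℂ) :
    BoxOp (fun z => c * g (z + s)) = fun z => c * BoxOp g (z + s) := by
  funext z
  simp only [BoxOp, pd_eq_dirD, dirD_const_mul_translate]
  rw [← Finset.mul_sum]
  ring

variable {d : ℕ}

lemma add_imV_coneMap_mem {z : Fin (d + 2) → ℂ} (hz : z ∈ tube (d + 2)) (α : ℝ)
    (w : Fin d ⊕ Fin d → ℝ) : z + imV (coneMap α w) ∈ tube (d + 2) := by
  rw [mem_tube, imP_add_imV]
  exact add_coneMap_mem_cone hz α w

lemma exists_cone_minorant {z₀ : Fin (d + 2) → ℂ} (hz₀ : z₀ ∈ tube (d + 2)) :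
    ∃ y ∈ cone (d + 2), ∃ r > 0, Metric.ball z₀ r ⊆ tube (d + 2) ∧
      ∀ z ∈ Metric.ball z₀ r, ∀ v, y + v ∈ cone (d + 2) →
        nA (y + v) ≤ nA (imP z + v) ∧ tau (y + v) ≤ tau (imP z + v) := by
  have hy : (1 / 2 : ℝ) • imP z₀ ∈ cone (d + 2) := by
    obtain ⟨h1, h2⟩ := hz₀
    refine ⟨?_, by simpa using h2⟩
    have : lor ((1 / 2 : ℝ) • imP z₀) = (1 / 4) * lor (imP z₀) := by
      simp only [lor, Pi.smul_apply, smul_eq_mul, mul_pow, ← Finset.mul_sum]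
      ring
    rw [this]
    positivity
  have hc : Continuous fun z : Fin (d + 2) → ℂ => imP z - (1 / 2 : ℝ) • imP z₀ :=
    continuous_imP.sub continuous_const
  have hmem : z₀ ∈ (fun z : Fin (d + 2) → ℂ => imP z - (1 / 2 : ℝ) • imP z₀) ⁻¹' cone (d + 2) := by
    have : imP z₀ - (1 / 2 : ℝ) • imP z₀ = (1 / 2 : ℝ) • imP z₀ := by
      funext i; simp; ring
    rw [mem_preimage, this]
    exact hy
  obtain ⟨r, hr, hball⟩ := Metric.isOpen_iff.1 (isOpen_cone.preimage hc) z₀ hmem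
  refine ⟨_, hy, r, hr, fun z hz => ?_, fun z hz v hv => ?_⟩
  · have := add_mem_cone (hball hz) hy
    rwa [sub_add_cancel] at this
  · obtain ⟨h1, h2⟩ := mem_cone_iff.1 (hball hz)
    have h3 := mem_cone_iff.1 hv
    have e : imP z + v = (imP z - (1 / 2 : ℝ) • imP z₀) + ((1 / 2 : ℝ) • imP z₀ + v) := by
      abel
    have h4 := tau_add h1 h3.1
    have h5 := nA_add (imP z - (1 / 2 : ℝ) • imP z₀) ((1 / 2 : ℝ) • imP z₀ + v)
    rw [← e] at h4 h5
    constructor <;> linarith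

lemma continuous_comp_coneMap {g : (Fin (d + 2) → ℂ) → ℂ}
    (hg : DifferentiableOn ℂ g (tube (d + 2))) {z : Fin (d + 2) → ℂ} (hz : z ∈ tube (d + 2)) :
    Continuous fun p : ℝ × (Fin d ⊕ Fin d → ℝ) => g (z + imV (coneMap p.1 p.2)) :=
  hg.continuousOn.comp_continuous
    (continuous_const.add (continuous_imV.comp continuous_coneMap))
    fun p => add_imV_coneMap_mem hz p.1 p.2

lemma Growth.norm_mul_le {k : ℕ} {M : ℝ} {g : (Fin (d + 2) → ℂ) → ℂ}
    (h : Growth (k + 1) (k + d) M g) {y : Fin (d + 2) → ℝ} (hy : y ∈ cone (d + 2))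
    {z : Fin (d + 2) → ℂ} {p : ℝ × (Fin d ⊕ Fin d → ℝ)} (hp : 0 < p.1)
    (hz : nA (y + coneMap p.1 p.2) ≤ nA (imP z + coneMap p.1 p.2) ∧
      tau (y + coneMap p.1 p.2) ≤ tau (imP z + coneMap p.1 p.2)) :
    ‖(p.1 : ℂ) * g (z + imV (coneMap p.1 p.2))‖ ≤ M * coneWeight k y p := by
  obtain ⟨h1, h2⟩ := mem_cone_iff.1 (add_coneMap_mem_cone hy p.1 p.2)
  rw [← imP_add_imV] at hz
  have h3 := h.le_of_le h1 h2 hz.1 hz.2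
  rw [norm_mul, Complex.norm_real, Real.norm_of_nonneg hp.le, coneWeight]
  calc p.1 * ‖g (z + imV (coneMap p.1 p.2))‖ ≤ p.1 * (M / (nA (y + coneMap p.1 p.2) ^ (k + 1) *
        tau (y + coneMap p.1 p.2) ^ (k + d))) := by gcongr
    _ = _ := by ring

lemma holFamily_cone {k : ℕ} (hk : (d : ℝ) / 2 < k) {M : ℝ} {g : (Fin (d + 2) → ℂ) → ℂ}
    (hg : DifferentiableOn ℂ g (tube (d + 2))) (h : Growth (k + 1) (k + d) M g) :
    HolFamily (tube (d + 2)) (coneMeas d)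
      fun z p => (p.1 : ℂ) * g (z + imV (coneMap p.1 p.2)) where
  diff := ae_of_all _ fun p => (hg.comp (by fun_prop)
    fun z hz => add_imV_coneMap_mem hz p.1 p.2).const_mul _
  meas z hz := ((by fun_prop : Continuous fun p : ℝ × (Fin d ⊕ Fin d → ℝ) => (p.1 : ℂ)).mul
    (continuous_comp_coneMap hg hz)).aestronglyMeasurable
  dom z₀ hz₀ := by
    obtain ⟨y, hy, r, hr, -, hdom⟩ := exists_cone_minorant hz₀
    refine ⟨r, hr, _, (integrable_coneWeight hk hy).1.const_mul M, ?_⟩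
    filter_upwards [ae_coneMeas_pos] with p hp z hz
    exact h.norm_mul_le hy hp (hdom z hz _ (add_coneMap_mem_cone hy p.1 p.2))

/-- The potential of `h` along the boundary of the cone. It inverts the wave operator, up to a
constant, on functions of suitable growth. -/
def conePot (h : (Fin (d + 2) → ℂ) → ℂ) (z : Fin (d + 2) → ℂ) : ℂ :=
  ∫ p, (p.1 : ℂ) * dirB^[d - 1] h (z + imV (coneMap p.1 p.2)) ∂coneMeas d

lemma exists_growth_conePot (hd : 1 ≤ d) {k : ℕ} (hk : (d : ℝ) / 2 < k) :
    ∃ C : ℝ, ∀ (N : ℝ) (h : (Fin (d + 2) → ℂ) → ℂ), DifferentiableOn ℂ h (tube (d + 2)) →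
      Growth (k + 1) (k + 1) N h →
        DifferentiableOn ℂ (conePot h) (tube (d + 2)) ∧ Growth k k (C * N) (conePot h) ∧
        EqOn (BoxOp (conePot h)) (conePot (BoxOp h)) (tube (d + 2)) ∧
        EqOn (dirB (conePot h)) (fun z => ∫ p, (p.1 : ℂ) *
          dirB^[d] h (z + imV (coneMap p.1 p.2)) ∂coneMeas d) (tube (d + 2)) := by
  obtain ⟨C, hC⟩ := Growth.dirB_iterate (d := d) (k + 1) (k + 1) (d - 1)
  rw [show k + 1 + (d - 1) = k + d by omega] at hC
  refine ⟨bracketInt d (k + d) / (2 * k - d) * C, fun N h hh hN => ?_⟩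
  have hg := (dirD_iterate_box isOpen_tube hh (nul 0 1 0) (d - 1))
  have hG := hC N h hh hN
  have hfam := holFamily_cone hk hg.1 hG
  refine ⟨hfam.differentiableOn isOpen_tube, fun z hz => ?_, fun z hz => ?_, fun z hz => ?_⟩
  · obtain ⟨hi, hv⟩ := integrable_coneWeight hk hz
    calc ‖conePot h z‖ ≤ ∫ p, C * N * coneWeight k (imP z) p ∂coneMeas d := by
          refine norm_integral_le_of_norm_le (hi.const_mul _) ?_
          filter_upwards [ae_coneMeas_pos] with p hp
          exact hG.norm_mul_le hz hp ⟨le_rfl, le_rfl⟩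
      _ = _ := by rw [integral_const_mul, hv]; ring
  · refine (box_integral isOpen_tube hfam hz).trans ?_
    refine integral_congr_ae (ae_of_all _ fun p => ?_)
    simp only [box_const_mul_translate]
    congr 1
    exact (hg.2 (add_imV_coneMap_mem hz p.1 p.2)).symm
  · refine (hfam.dirD_integral isOpen_tube _ hz).trans ?_
    refine integral_congr_ae (ae_of_all _ fun p => ?_)
    simp only [dirD_const_mul_translate]
    congr 1
    obtain ⟨e, rfl⟩ : ∃ e, d = e + 1 := ⟨d - 1, by omega⟩
    rw [Function.iterate_succ_apply']
    rfl

end ConePotential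

/-! ### A radial integral -/

section RadialIntegral

/-- The constants in the radial integration formula. -/
def radialConst : ℕ → ℂ
  | 0 => I / 2
  | N + 1 => (N + 1) * I * radialConst N

lemma radialConst_ne_zero (N : ℕ) : radialConst N ≠ 0 := by
  induction N with
  | zero => simp [radialConst]
  | succ N ih =>
    rw [radialConst]
    exact mul_ne_zero (mul_ne_zero (by exact_mod_cast N.succ_ne_zero) I_ne_zero) ih

variable {Φ : ℕ → ℝ → ℂ} {C : ℕ → ℝ} {T : ℝ}

lemma tendsto_inv_add_sq (T : ℝ) :
    Filter.Tendsto (fun r : ℝ => (T + r ^ 2)⁻¹) Filter.atTop (nhds 0) :=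
  (Filter.tendsto_atTop_add_const_left _ _
    (Filter.tendsto_pow_atTop two_ne_zero)).inv_tendsto_atTop

lemma integrableOn_radial (hT : 0 < T)
    (hc : ∀ q, ContinuousOn (Φ q) (Ici 0))
    (hb : ∀ q, ∀ s, 0 ≤ s → ‖Φ q s‖ ≤ C q * ((T + s) ^ q)⁻¹) (N : ℕ) :
    IntegrableOn (fun r : ℝ => (r : ℂ) ^ (2 * N + 1) * Φ (N + 2) (r ^ 2)) (Ioi 0) := by
  have h0 : IntegrableOn (fun r : ℝ => r * ((T + r ^ 2) ^ 2)⁻¹) (Ioi 0) := by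
    refine integrableOn_Ioi_deriv_of_nonneg' (g := fun r => -((T + r ^ 2)⁻¹) / 2) (l := 0) ?_ ?_ ?_
    · intro r _
      have hp : T + r ^ 2 ≠ 0 := by positivity
      have h1 : HasDerivAt (fun r : ℝ => T + r ^ 2) (2 * r) r := by
        simpa using ((hasDerivAt_id r).pow 2).const_add T
      refine ((h1.inv hp).neg.div_const 2).congr_deriv ?_
      field_simp
    · intro r hr
      have : (0 : ℝ) < r := hr
      positivity
    · simpa using (tendsto_inv_add_sq T).neg.div_const 2
  refine (h0.const_mul (C (N + 2))).mono' ?_ ?_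
  · refine ContinuousOn.aestronglyMeasurable ?_ measurableSet_Ioi
    refine ContinuousOn.mul (by fun_prop) ((hc _).comp (by fun_prop) fun r _ => ?_)
    exact sq_nonneg r
  · refine (ae_restrict_iff' measurableSet_Ioi).2 (ae_of_all _ fun r hr => ?_)
    have hr0 : (0 : ℝ) < r := hr
    have h1 := hb (N + 2) (r ^ 2) (sq_nonneg r)
    have h2 : r ^ (2 * N + 1) * ((T + r ^ 2) ^ (N + 2))⁻¹ ≤ r * ((T + r ^ 2) ^ 2)⁻¹ := by
      have h3 : (r ^ 2) ^ N ≤ (T + r ^ 2) ^ N := by gcongr; linarith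
      rw [← div_eq_mul_inv, ← div_eq_mul_inv, div_le_div_iff₀ (by positivity) (by positivity)]
      calc r ^ (2 * N + 1) * (T + r ^ 2) ^ 2 = r * (r ^ 2) ^ N * (T + r ^ 2) ^ 2 := by ring
        _ ≤ r * (T + r ^ 2) ^ N * (T + r ^ 2) ^ 2 := by gcongr
        _ = _ := by ring
    have h4 : 0 ≤ C (N + 2) := by
      have := (norm_nonneg _).trans h1
      exact nonneg_of_mul_nonneg_left this (by positivity)
    rw [norm_mul, norm_pow, Complex.norm_real, Real.norm_of_nonneg hr0.le]
    calc _ ≤ r ^ (2 * N + 1) * (C (N + 2) * ((T + r ^ 2) ^ (N + 2))⁻¹) := by gcongr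
      _ = C (N + 2) * (r ^ (2 * N + 1) * ((T + r ^ 2) ^ (N + 2))⁻¹) := by ring
      _ ≤ _ := by gcongr

lemma tendsto_radial (hT : 0 < T)
    (hb : ∀ q, ∀ s, 0 ≤ s → ‖Φ q s‖ ≤ C q * ((T + s) ^ q)⁻¹) (N : ℕ) :
    Filter.Tendsto (fun r : ℝ => (r : ℂ) ^ (2 * N) * Φ (N + 1) (r ^ 2)) Filter.atTop
      (nhds 0) := by
  refine squeeze_zero_norm' (a := fun r => C (N + 1) * (T + r ^ 2)⁻¹) ?_
    (by simpa using (tendsto_inv_add_sq T).const_mul (C (N + 1)))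
  filter_upwards [Filter.eventually_gt_atTop 0] with r hr
  have h1 := hb (N + 1) (r ^ 2) (sq_nonneg r)
  have h4 : 0 ≤ C (N + 1) := by
    have := (norm_nonneg _).trans h1
    exact nonneg_of_mul_nonneg_left this (by positivity)
  have h3 : (r ^ 2) ^ N ≤ (T + r ^ 2) ^ N := by gcongr; linarith
  rw [norm_mul, norm_pow, Complex.norm_real, Real.norm_of_nonneg hr.le]
  calc _ ≤ r ^ (2 * N) * (C (N + 1) * ((T + r ^ 2) ^ (N + 1))⁻¹) := by gcongr
    _ = C (N + 1) * ((r ^ 2) ^ N * ((T + r ^ 2) ^ (N + 1))⁻¹) := by ring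
    _ ≤ C (N + 1) * ((T + r ^ 2) ^ N * ((T + r ^ 2) ^ (N + 1))⁻¹) := by gcongr
    _ = _ := by field_simp; ring

lemma integral_radial (hT : 0 < T)
    (hd : ∀ q, ∀ s, 0 ≤ s → HasDerivAt (Φ q) (I * Φ (q + 1) s) s)
    (hb : ∀ q, ∀ s, 0 ≤ s → ‖Φ q s‖ ≤ C q * ((T + s) ^ q)⁻¹) (N : ℕ) :
    ∫ r in Ioi (0 : ℝ), (r : ℂ) ^ (2 * N + 1) * Φ (N + 2) (r ^ 2) = radialConst N * Φ 1 0 := by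
  have hc : ∀ q, ContinuousOn (Φ q) (Ici 0) := fun q s hs =>
    (hd q s hs).continuousAt.continuousWithinAt
  have hsq : ∀ q, ∀ r : ℝ, HasDerivAt (fun r : ℝ => Φ q (r ^ 2))
      (2 * r * (I * Φ (q + 1) (r ^ 2))) r := by
    intro q r
    have h1 : HasDerivAt (fun r : ℝ => r ^ 2) (2 * r) r := by
      simpa using hasDerivAt_pow 2 r
    refine (HasDerivAt.scomp (h := fun r : ℝ => r ^ 2) r
      (hd q (r ^ 2) (sq_nonneg r)) h1).congr_deriv ?_
    rw [Complex.real_smul]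
    push_cast
    ring
  induction N with
  | zero =>
    have hInt := (integrableOn_radial hT hc hb 0).const_mul (2 * I)
    have h1 := integral_Ioi_of_hasDerivAt_of_tendsto' (f := fun r => Φ 1 (r ^ 2))
      (f' := fun r : ℝ => 2 * I * ((r : ℂ) ^ (2 * 0 + 1) * Φ (0 + 2) (r ^ 2))) (a := 0) (m := 0)
      (fun r _ => (hsq 1 r).congr_deriv (by ring)) hInt
      (by simpa using tendsto_radial hT hb 0)
    rw [integral_const_mul] at h1
    have h2 : (2 * I)⁻¹ * (2 * I) = 1 := inv_mul_cancel₀ (by simp)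
    calc _ = (2 * I)⁻¹ * (2 * I * ∫ r in Ioi (0 : ℝ), (r : ℂ) ^ (2 * 0 + 1) *
          Φ (0 + 2) (r ^ 2)) := by rw [← mul_assoc, h2, one_mul]
      _ = _ := by
        rw [h1, radialConst]
        have : (I : ℂ)⁻¹ = -I := inv_I
        rw [mul_inv, this]
        simp
        ring_nf
        simp
  | succ N ih =>
    have hi1 := (integrableOn_radial hT hc hb N).const_mul (2 * (N + 1) : ℂ)
    have hi2 := (integrableOn_radial hT hc hb (N + 1)).const_mul (2 * I)
    have hder : ∀ r ∈ Ici (0 : ℝ), HasDerivAt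
        (fun r : ℝ => (r : ℂ) ^ (2 * (N + 1)) * Φ (N + 2) (r ^ 2))
        (2 * (N + 1) * ((r : ℂ) ^ (2 * N + 1) * Φ (N + 2) (r ^ 2)) +
          2 * I * ((r : ℂ) ^ (2 * (N + 1) + 1) * Φ (N + 1 + 2) (r ^ 2))) r := by
      intro r _
      have h1 : HasDerivAt (fun r : ℝ => (r : ℂ) ^ (2 * (N + 1)))
          (2 * (N + 1) * (r : ℂ) ^ (2 * N + 1)) r := by
        have := (hasDerivAt_id r).ofReal_comp.pow (2 * (N + 1))
        refine this.congr_deriv ?_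
        simp [show 2 * (N + 1) - 1 = 2 * N + 1 by omega]
      refine (h1.mul (hsq (N + 2) r)).congr_deriv ?_
      ring
    have h1 := integral_Ioi_of_hasDerivAt_of_tendsto' hder (hi1.add hi2)
      (tendsto_radial hT hb (N + 1))
    rw [integral_add hi1 hi2, integral_const_mul, integral_const_mul, ih] at h1
    have h2 : (2 * I)⁻¹ * (2 * I) = 1 := inv_mul_cancel₀ (by simp)
    simp only [ofReal_zero] at h1
    rw [zero_pow (by omega), zero_mul, sub_zero] at h1
    calc _ = (2 * I)⁻¹ * (2 * I * ∫ r in Ioi (0 : ℝ), (r : ℂ) ^ (2 * (N + 1) + 1) *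
          Φ (N + 1 + 2) (r ^ 2)) := by rw [← mul_assoc, h2, one_mul]
      _ = _ := by
        rw [eq_neg_of_add_eq_zero_right h1, radialConst, mul_inv, inv_I]
        ring

lemma exists_integral_radial {d : ℕ} (hd : 1 ≤ d) : ∃ κ : ℂ, κ ≠ 0 ∧
    ∀ (Φ : ℕ → ℝ → ℂ) (C : ℕ → ℝ) (T : ℝ), 0 < T →
      (∀ q, ∀ s, 0 ≤ s → HasDerivAt (Φ q) (I * Φ (q + 1) s) s) →
      (∀ q, ∀ s, 0 ≤ s → ‖Φ q s‖ ≤ C q * ((T + s) ^ q)⁻¹) →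
      ∫ w : Fin d ⊕ Fin d → ℝ, Φ (d + 1) (∑ i, w i ^ 2) = κ * Φ 1 0 := by
  obtain ⟨e, rfl⟩ : ∃ e, d = e + 1 := ⟨d - 1, by omega⟩
  set E := EuclideanSpace ℝ (Fin (e + 1) ⊕ Fin (e + 1))
  set v : ℝ := Module.finrank ℝ E * (volume : Measure E).real (Metric.ball 0 1) with hv
  have hv0 : v ≠ 0 := by
    refine mul_ne_zero (Nat.cast_ne_zero.2 (by simp [E])) ?_
    exact (ENNReal.toReal_pos (Metric.isOpen_ball.measure_pos _ ⟨0, by simp⟩).ne'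
      measure_ball_lt_top.ne).ne'
  refine ⟨v * radialConst e, mul_ne_zero (by exact_mod_cast hv0) (radialConst_ne_zero e),
    fun Φ C T hT hder hb => ?_⟩
  have h1 : ∫ w : Fin (e + 1) ⊕ Fin (e + 1) → ℝ, Φ (e + 1 + 1) (∑ i, w i ^ 2) =
      ∫ x : E, Φ (e + 1 + 1) (‖x‖ ^ 2) := by
    rw [← (EuclideanSpace.volume_preserving_symm_measurableEquiv_toLp
      (Fin (e + 1) ⊕ Fin (e + 1))).symm.integral_comp']
    refine integral_congr_ae (ae_of_all _ fun w => ?_)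
    beta_reduce
    rw [EuclideanSpace.norm_sq_eq]
    simp
  rw [h1, integral_fun_norm_addHaar (volume : Measure E) fun r => Φ (e + 1 + 1) (r ^ 2)]
  have hdim : Module.finrank ℝ E - 1 = 2 * e + 1 := by
    simp [E]; omega
  have h2 : ∫ y in Ioi (0 : ℝ), y ^ (Module.finrank ℝ E - 1) • Φ (e + 1 + 1) (y ^ 2) =
      radialConst e * Φ 1 0 := by
    rw [← integral_radial hT hder hb e, hdim]
    refine integral_congr_ae (ae_of_all _ fun r => ?_)
    simp
  rw [h2, nsmul_eq_mul, Complex.real_smul, hv]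
  push_cast
  ring

end RadialIntegral

/-! ### Slices of the cone integral -/

section Slices

variable {d : ℕ}

lemma bracket_le_tau {y : Fin (d + 2) → ℝ} (hy : y ∈ cone (d + 2)) (R : ℝ) :
    ∃ C > 0, ∀ α : ℝ, |α| ≤ R → ∀ w : Fin d ⊕ Fin d → ℝ,
      1 + ∑ i, w i ^ 2 ≤ C * tau (y + coneMap α w) := by
  obtain ⟨ha, ht⟩ := mem_cone_iff.1 hy
  set S : ℝ := ∑ j : Fin d, (R * y j.succ.succ / nA y) ^ 2
  have hS : 0 ≤ S := by positivity
  refine ⟨(1 + 2 * S) / tau y + (1 + 2 * (nA y + R ^ 2) / nA y), by positivity,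
    fun α hα w => ?_⟩
  have hα2 : α ^ 2 ≤ R ^ 2 := sq_le_sq' (abs_le.1 hα).1 (abs_le.1 hα).2
  have hR : 0 < nA y + R ^ 2 := by positivity
  set P := ∑ j, nA y / (nA y + α ^ 2) * (w (Sum.inl j) - α * y j.succ.succ / nA y) ^ 2 with hP
  set Q := ∑ j, w (Sum.inr j) ^ 2 with hQ
  have hP0 : 0 ≤ P := Finset.sum_nonneg fun j _ => by positivity
  have hQ0 : 0 ≤ Q := by positivity
  have h1 : ∑ j, w (Sum.inl j) ^ 2 ≤ 2 * (nA y + R ^ 2) / nA y * P + 2 * S := by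
    rw [hP, Finset.mul_sum, Finset.mul_sum, ← Finset.sum_add_distrib]
    refine Finset.sum_le_sum fun j _ => ?_
    have h2 : (α * y j.succ.succ / nA y) ^ 2 ≤ (R * y j.succ.succ / nA y) ^ 2 := by
      rw [mul_div_assoc, mul_div_assoc, mul_pow, mul_pow]
      gcongr
    have h3 : 1 ≤ (nA y + R ^ 2) / nA y * (nA y / (nA y + α ^ 2)) := by
      rw [div_mul_div_cancel₀ ha.ne', le_div_iff₀ (by positivity)]
      linarith
    have h4 := mul_le_mul_of_nonneg_right h3
      (sq_nonneg (w (Sum.inl j) - α * y j.succ.succ / nA y))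
    have h5 := sq_nonneg (w (Sum.inl j) - 2 * (α * y j.succ.succ / nA y))
    calc w (Sum.inl j) ^ 2 ≤ 2 * (1 * (w (Sum.inl j) - α * y j.succ.succ / nA y) ^ 2) +
          2 * (α * y j.succ.succ / nA y) ^ 2 := by nlinarith
      _ ≤ 2 * ((nA y + R ^ 2) / nA y * (nA y / (nA y + α ^ 2)) *
          (w (Sum.inl j) - α * y j.succ.succ / nA y) ^ 2) + 2 * (R * y j.succ.succ / nA y) ^ 2 := by
            gcongr
      _ = _ := by ring
  rw [Fintype.sum_sum_type, tau_add_coneMap ha, ← hP, ← hQ]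
  have e1 : (1 + 2 * S) / tau y * (tau y + Q + P) =
      (1 + 2 * S) + (1 + 2 * S) / tau y * (Q + P) := by
    field_simp; ring
  have e2 : 0 ≤ (1 + 2 * S) / tau y * (Q + P) := by positivity
  have e3 : 0 ≤ 2 * (nA y + R ^ 2) / nA y * (tau y + Q) := by positivity
  rw [add_mul, e1]
  linarith

/-- Uniform decay of `g` on the translates of a ball around `z` along a family of slices of the
boundary of the cone. -/
def SliceBound (l : ℕ) (z : Fin (d + 2) → ℂ) (R : ℝ) (g : (Fin (d + 2) → ℂ) → ℂ) : Prop :=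
  ∃ r > 0, Metric.ball z r ⊆ tube (d + 2) ∧ ∃ C, 0 ≤ C ∧ ∀ α : ℝ, |α| ≤ R →
    ∀ w : Fin d ⊕ Fin d → ℝ, ∀ z' ∈ Metric.ball z r,
      ‖g (z' + imV (coneMap α w))‖ ≤ C * ((1 + ∑ i, w i ^ 2) ^ l)⁻¹

lemma Growth.sliceBound {k l : ℕ} {M : ℝ} {g : (Fin (d + 2) → ℂ) → ℂ} (h : Growth k l M g)
    {z : Fin (d + 2) → ℂ} (hz : z ∈ tube (d + 2)) (R : ℝ) : SliceBound l z R g := by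
  obtain ⟨y, hy, r, hr, hball, hdom⟩ := exists_cone_minorant hz
  obtain ⟨c, hc, hcb⟩ := bracket_le_tau hy R
  obtain ⟨ha, -⟩ := mem_cone_iff.1 hy
  have hM := h.nonneg
  refine ⟨r, hr, hball, M * c ^ l / nA y ^ k, by positivity, fun α hα w z' hz' => ?_⟩
  obtain ⟨h1, h2⟩ := hdom z' hz' _ (add_coneMap_mem_cone hy α w)
  rw [nA_add_coneMap] at h1
  rw [← imP_add_imV] at h1 h2
  have h3 : (1 + ∑ i, w i ^ 2) / c ≤ tau (imP (z' + imV (coneMap α w))) := by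
    rw [div_le_iff₀ hc]
    linarith [hcb α hα w, mul_le_mul_of_nonneg_left h2 hc.le]
  refine (h.le_of_le ha (t := (1 + ∑ i, w i ^ 2) / c) (by positivity)
    (by linarith [sq_nonneg α]) h3).trans_eq ?_
  rw [div_pow]
  field_simp

lemma SliceBound.fderiv {l : ℕ} {R : ℝ} {g : (Fin (d + 2) → ℂ) → ℂ} {z : Fin (d + 2) → ℂ}
    (hg : DifferentiableOn ℂ g (tube (d + 2))) (h : SliceBound l z R g) :
    ∃ r > 0, Metric.ball z r ⊆ tube (d + 2) ∧ ∃ C, 0 ≤ C ∧ ∀ α : ℝ, |α| ≤ R →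
      ∀ w : Fin d ⊕ Fin d → ℝ, ∀ z' ∈ Metric.ball z r, ∀ v,
        ‖dirD v g (z' + imV (coneMap α w))‖ ≤ C * ‖v‖ * ((1 + ∑ i, w i ^ 2) ^ l)⁻¹ := by
  obtain ⟨r, hr, hball, C, hC, hb⟩ := h
  refine ⟨r / 2, by positivity, (Metric.ball_subset_ball (by linarith)).trans hball, C * (4 / r),
    by positivity, fun α hα w z' hz' v => ?_⟩
  have h1 := norm_fderiv_le (f := fun z => g (z + imV (coneMap α w))) hr
    (hg.comp (by fun_prop) fun z hz => add_imV_coneMap_mem (hball hz) α w) (hb α hα w) hz'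
  rw [fderiv_comp_add_right] at h1
  refine ((_root_.fderiv ℂ g _).le_opNorm v).trans ?_
  calc _ ≤ C * ((1 + ∑ i, w i ^ 2) ^ l)⁻¹ * (4 / r) * ‖v‖ := by gcongr
    _ = _ := by ring

lemma SliceBound.dirD {l : ℕ} {R : ℝ} {g : (Fin (d + 2) → ℂ) → ℂ} {z : Fin (d + 2) → ℂ}
    (hg : DifferentiableOn ℂ g (tube (d + 2))) (h : SliceBound l z R g) (v : Fin (d + 2) → ℂ) :
    SliceBound l z R (dirD v g) := by
  obtain ⟨r, hr, hball, C, hC, hb⟩ := h.fderiv hg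
  exact ⟨r, hr, hball, C * ‖v‖, by positivity, fun α hα w z' hz' => hb α hα w z' hz' v⟩

lemma SliceBound.at_center {l : ℕ} {R : ℝ} {g : (Fin (d + 2) → ℂ) → ℂ} {z : Fin (d + 2) → ℂ}
    (h : SliceBound l z R g) : ∃ C, 0 ≤ C ∧ ∀ α : ℝ, |α| ≤ R → ∀ w : Fin d ⊕ Fin d → ℝ,
      ‖g (z + imV (coneMap α w))‖ ≤ C * ((1 + ∑ i, w i ^ 2) ^ l)⁻¹ := by
  obtain ⟨r, hr, -, C, hC, hb⟩ := h
  exact ⟨C, hC, fun α hα w => hb α hα w z (Metric.mem_ball_self hr)⟩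

lemma continuous_comp_coneMap_slice {g : (Fin (d + 2) → ℂ) → ℂ}
    (hg : DifferentiableOn ℂ g (tube (d + 2))) {z : Fin (d + 2) → ℂ} (hz : z ∈ tube (d + 2))
    (α : ℝ) : Continuous fun w => g (z + imV (coneMap α w)) :=
  ((continuous_comp_coneMap hg hz).comp (Continuous.prodMk_right α) :)

lemma SliceBound.integrable {l : ℕ} (hl : d < l) {R α : ℝ} (hα : |α| ≤ R)
    {g : (Fin (d + 2) → ℂ) → ℂ} {z : Fin (d + 2) → ℂ} (h : SliceBound l z R g)
    (hg : DifferentiableOn ℂ g (tube (d + 2))) (hz : z ∈ tube (d + 2)) :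
    Integrable fun w => g (z + imV (coneMap α w)) := by
  obtain ⟨C, -, hb⟩ := h.at_center
  exact ((integrable_bracket hl).const_mul C).mono'
    (continuous_comp_coneMap_slice hg hz α).aestronglyMeasurable (ae_of_all _ (hb α hα))

lemma abs_coord_le (w : Fin d ⊕ Fin d → ℝ) (i : Fin d ⊕ Fin d) : |w i| ≤ 1 + ∑ i, w i ^ 2 := by
  have h1 : w i ^ 2 ≤ ∑ i, w i ^ 2 :=
    Finset.single_le_sum (f := fun i => w i ^ 2) (fun i _ => sq_nonneg _) (Finset.mem_univ i)
  rw [← sq_abs] at h1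
  nlinarith [sq_nonneg (|w i| - 1)]

lemma SliceBound.coord_mul {l : ℕ} {R : ℝ}
    {g : (Fin (d + 2) → ℂ) → ℂ} {z : Fin (d + 2) → ℂ} (h : SliceBound (l + 1) z R g)
    (i : Fin d ⊕ Fin d) : ∃ C, 0 ≤ C ∧ ∀ α : ℝ, |α| ≤ R → ∀ w : Fin d ⊕ Fin d → ℝ,
      ‖(w i : ℂ) * g (z + imV (coneMap α w))‖ ≤ C * ((1 + ∑ i, w i ^ 2) ^ l)⁻¹ := by
  obtain ⟨C, hC, hb⟩ := h.at_center
  refine ⟨C, hC, fun α hα w => ?_⟩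
  rw [norm_mul, Complex.norm_real, Real.norm_eq_abs]
  calc _ ≤ (1 + ∑ i, w i ^ 2) * (C * ((1 + ∑ i, w i ^ 2) ^ (l + 1))⁻¹) := by
        gcongr
        exacts [abs_coord_le w i, hb α hα w]
    _ = _ := by
      have : 0 < 1 + ∑ i, w i ^ 2 := by positivity
      field_simp
      ring

lemma hasDerivAt_comp_imV {n : ℕ} {U : Set (Fin n → ℂ)} (hU : IsOpen U) {g : (Fin n → ℂ) → ℂ}
    (hg : DifferentiableOn ℂ g U) {γ : ℝ → Fin n → ℝ} {γ' : Fin n → ℝ} {t : ℝ} {z : Fin n → ℂ}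
    (hγ : HasDerivAt γ γ' t) (hz : z + imV (γ t) ∈ U) :
    HasDerivAt (fun t => g (z + imV (γ t))) (dirD (imV γ') g (z + imV (γ t))) t := by
  have h1 : HasDerivAt (fun t => z + imV (γ t)) (imV γ') t := by
    refine HasDerivAt.const_add z (hasDerivAt_pi.2 fun i => ?_)
    exact ((hasDerivAt_pi.1 hγ i).ofReal_comp).const_mul I
  have h2 := ((hg _ hz).differentiableAt (hU.mem_nhds hz)).hasFDerivAt.restrictScalars ℝ
  exact h2.comp_hasDerivAt t h1

lemma hasDerivAt_nul {a b : ℝ → ℝ} {c : ℝ → Fin d → ℝ} {a' b' t : ℝ} {c' : Fin d → ℝ}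
    (ha : HasDerivAt a a' t) (hb : HasDerivAt b b' t) (hc : ∀ j, HasDerivAt (c · j) (c' j) t) :
    HasDerivAt (fun t => nul (a t) (b t) (c t)) (nul a' b' c') t := by
  refine hasDerivAt_pi.2 fun i => ?_
  refine Fin.cases ?_ (Fin.cases ?_ fun j => ?_) i
  · exact (ha.add hb).div_const 2
  · exact (ha.sub hb).div_const 2
  · exact hc j

lemma dirD_imV_nul (a b : ℝ) (t : Fin d → ℝ) (g : (Fin (d + 2) → ℂ) → ℂ) (z : Fin (d + 2) → ℂ) :
    dirD (imV (nul a b t)) g z = I * (a * dirD (nul 1 0 0) g z + b * dirD (nul 0 1 0) g z +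
      ∑ j, t j * dirD (nul 0 0 (Pi.single j 1)) g z) := by
  have h : imV (nul a b t) = I • nul (a : ℂ) b fun j => (t j : ℂ) := by
    rw [← ofReal_nul]; rfl
  rw [dirD, h, nul_eq]
  simp only [dirD, map_smul, map_add, map_sum, smul_eq_mul]

end Slices

/-! ### Differentiation of slice integrals -/

section SliceDerivative

variable {d : ℕ} {G : (Fin (d + 2) → ℂ) → ℂ} {z : Fin (d + 2) → ℂ}

/-- The transverse derivatives. -/
def dirT (j : Fin d) (f : (Fin (d + 2) → ℂ) → ℂ) : (Fin (d + 2) → ℂ) → ℂ :=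
  dirD (nul 0 0 (Pi.single j 1)) f

lemma hasLineDerivAt_comp_coneMap (hG : DifferentiableOn ℂ G (tube (d + 2)))
    (hz : z ∈ tube (d + 2)) (α : ℝ) (j : Fin d) (w : Fin d ⊕ Fin d → ℝ) :
    HasLineDerivAt ℝ (fun w => G (z + imV (coneMap α w)))
      (I * (2 * (w (Sum.inl j) * dirB G (z + imV (coneMap α w))) +
        α * dirT j G (z + imV (coneMap α w)))) w (Pi.single (Sum.inl j) 1) := by
  have hi : ∀ i, HasDerivAt (fun t : ℝ => (w + t • (Pi.single (Sum.inl j) 1 :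
      Fin d ⊕ Fin d → ℝ)) i) ((Pi.single (Sum.inl j) 1 : Fin d ⊕ Fin d → ℝ) i) 0 := by
    intro i
    simpa using ((hasDerivAt_id (0 : ℝ)).mul_const
      ((Pi.single (Sum.inl j) 1 : Fin d ⊕ Fin d → ℝ) i)).const_add (w i)
  have hb : HasDerivAt (fun t : ℝ => ∑ i, ((w + t • (Pi.single (Sum.inl j) 1 :
      Fin d ⊕ Fin d → ℝ)) i) ^ 2) (2 * w (Sum.inl j)) 0 := by
    refine (HasDerivAt.fun_sum fun i _ => (hi i).fun_pow 2).congr_deriv ?_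
    simp [Pi.single_apply]
  have hγ : HasDerivAt (fun t : ℝ => coneMap α (w + t • (Pi.single (Sum.inl j) 1 :
      Fin d ⊕ Fin d → ℝ))) (nul 0 (2 * w (Sum.inl j)) (Pi.single j α)) 0 := by
    refine hasDerivAt_nul (hasDerivAt_const _ _) hb fun i => ?_
    refine ((hi (Sum.inl i)).const_mul α).congr_deriv ?_
    simp [Pi.single_apply]
  have h0 : coneMap α (w + (0 : ℝ) • (Pi.single (Sum.inl j) 1 : Fin d ⊕ Fin d → ℝ)) =
      coneMap α w := by rw [zero_smul, add_zero]
  have h := hasDerivAt_comp_imV isOpen_tube hG hγ (z := z)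
    (by rw [h0]; exact add_imV_coneMap_mem hz α w)
  refine HasDerivAt.congr_deriv h ?_
  rw [h0, dirD_imV_nul]
  simp only [Pi.single_apply, dirB, dirT, ofReal_zero, zero_mul, zero_add]
  rw [Finset.sum_eq_single j (by intro i _ hi; simp [hi]) (by simp)]
  push_cast
  simp
  ring

lemma integrable_coord_mul {l : ℕ} (hl : d < l) {R α : ℝ} (hα : |α| ≤ R)
    {g : (Fin (d + 2) → ℂ) → ℂ} (h : SliceBound (l + 1) z R g)
    (hg : DifferentiableOn ℂ g (tube (d + 2))) (hz : z ∈ tube (d + 2)) (i : Fin d ⊕ Fin d) :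
    Integrable fun w : Fin d ⊕ Fin d → ℝ => (w i : ℂ) * g (z + imV (coneMap α w)) := by
  obtain ⟨C, -, hb⟩ := h.coord_mul i
  refine ((integrable_bracket hl).const_mul C).mono' ?_ (ae_of_all _ (hb α hα))
  exact ((by fun_prop : Continuous fun w : Fin d ⊕ Fin d → ℝ => (w i : ℂ)).mul
    (continuous_comp_coneMap_slice hg hz α)).aestronglyMeasurable

lemma integral_transverse {l : ℕ} (hl : d < l) {R α : ℝ} (hα : |α| ≤ R)
    (hG : DifferentiableOn ℂ G (tube (d + 2))) (hz : z ∈ tube (d + 2))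
    (h : SliceBound l z R G) (h' : SliceBound (l + 1) z R (dirB G)) (j : Fin d) :
    ∫ w : Fin d ⊕ Fin d → ℝ, (2 * (w (Sum.inl j) * dirT j (dirB G) (z + imV (coneMap α w))) +
      α * dirT j (dirT j G) (z + imV (coneMap α w))) = 0 := by
  have hB : DifferentiableOn ℂ (dirB G) (tube (d + 2)) := differentiableOn_dirD isOpen_tube hG _
  have hT : DifferentiableOn ℂ (dirT j G) (tube (d + 2)) := differentiableOn_dirD isOpen_tube hG _
  have hi1 := integrable_coord_mul hl hα (h'.dirD hB (nul 0 0 (Pi.single j 1)))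
    (differentiableOn_dirD isOpen_tube hB _) hz (Sum.inl j)
  have hi2 := SliceBound.integrable hl hα ((h.dirD hG _).dirD hT (nul 0 0 (Pi.single j 1)))
    (differentiableOn_dirD isOpen_tube hT _) hz
  have hi3 := SliceBound.integrable hl hα (h.dirD hG (nul 0 0 (Pi.single j 1))) hT hz
  have hi4 := ((hi1.const_mul 2).add (hi2.const_mul (α : ℂ))).const_mul I
  have key := integral_bilinear_hasLineDerivAt_right_eq_neg_left_of_integrable (μ := volume)
    (f := fun _ : Fin d ⊕ Fin d → ℝ => (1 : ℝ)) (f' := fun _ => 0)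
    (g := fun w => dirT j G (z + imV (coneMap α w)))
    (g' := fun w => I * (2 * (w (Sum.inl j) * dirT j (dirB G) (z + imV (coneMap α w))) +
      α * dirT j (dirT j G) (z + imV (coneMap α w)))) (v := Pi.single (Sum.inl j) 1)
    (B := ContinuousLinearMap.lsmul ℝ ℝ) (by simp) (by simpa [dirT] using hi4)
    (by simpa [dirT] using hi3)
    (fun _ _ => hasDerivAt_const (0 : ℝ) (1 : ℝ))
    (fun w _ => by
      have := hasLineDerivAt_comp_coneMap hT hz α j w
      rwa [dirB, dirT, dirD_comm isOpen_tube hG _ _ (add_imV_coneMap_mem hz α w)] at this)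
  simp only [ContinuousLinearMap.lsmul_apply, one_smul, zero_smul, integral_zero, neg_zero] at key
  rw [integral_const_mul] at key
  exact (mul_eq_zero.1 key).resolve_left I_ne_zero

/-- The integral of `g` over a slice. -/
def sliceInt (g : (Fin (d + 2) → ℂ) → ℂ) (z : Fin (d + 2) → ℂ) (α : ℝ) : ℂ :=
  ∫ w, g (z + imV (coneMap α w))

lemma hasDerivAt_coneMap (α : ℝ) (w : Fin d ⊕ Fin d → ℝ) :
    HasDerivAt (fun α => coneMap α w) (nul (2 * α) 0 fun j => w (Sum.inl j)) α := by
  refine hasDerivAt_nul ?_ (hasDerivAt_const _ _) fun j => ?_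
  · simpa using hasDerivAt_pow 2 α
  · simpa using (hasDerivAt_id α).mul_const (w (Sum.inl j))

lemma hasDerivAt_sliceInt {l : ℕ} (hl : d < l) (hG : DifferentiableOn ℂ G (tube (d + 2)))
    (hz : z ∈ tube (d + 2)) (h : ∀ R, SliceBound l z R G)
    (h' : ∀ R, SliceBound (l + 1) z R (dirB G)) (α : ℝ) :
    HasDerivAt (sliceInt (dirB G) z) (-(I / 2) * (α * sliceInt (BoxOp G) z α)) α := by
  have hB : DifferentiableOn ℂ (dirB G) (tube (d + 2)) := differentiableOn_dirD isOpen_tube hG _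
  set R := |α| + 1
  have hR : |α| ≤ R := by simp [R]
  obtain ⟨r, hr, -, C, hC, hb⟩ := (h' R).fderiv hB
  have hA : DifferentiableOn ℂ (dirD (nul 1 0 0) (dirB G)) (tube (d + 2)) :=
    differentiableOn_dirD isOpen_tube hB _
  have hTB : ∀ j, DifferentiableOn ℂ (dirT j (dirB G)) (tube (d + 2)) := fun j =>
    differentiableOn_dirD isOpen_tube hB _
  have hTT : ∀ j, DifferentiableOn ℂ (dirT j (dirT j G)) (tube (d + 2)) := fun j =>
    differentiableOn_dirD isOpen_tube (differentiableOn_dirD isOpen_tube hG _) _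
  have hnorm : ∀ β, |β| ≤ R → ∀ w : Fin d ⊕ Fin d → ℝ,
      ‖imV (nul (2 * β) 0 fun j => w (Sum.inl j))‖ ≤ (R + 1) * (1 + ∑ i, w i ^ 2) := by
    intro β hβ w
    have hw : 0 ≤ ∑ i, w i ^ 2 := by positivity
    have hR0 : 0 ≤ R := (abs_nonneg _).trans hR
    refine (pi_norm_le_iff_of_nonneg (by positivity)).2 fun i => ?_
    rw [imV, norm_mul, norm_I, one_mul, Complex.norm_real, Real.norm_eq_abs]
    refine Fin.cases ?_ (Fin.cases ?_ fun j => ?_) i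
    · rw [nul_zero]
      simp only [add_zero, mul_div_cancel_left₀ _ (two_ne_zero' ℝ)]
      nlinarith
    · rw [Fin.succ_zero_eq_one, nul_one]
      simp only [sub_zero, mul_div_cancel_left₀ _ (two_ne_zero' ℝ)]
      nlinarith
    · rw [nul_succ]
      nlinarith [abs_coord_le w (Sum.inl j)]
  have hder := hasDerivAt_integral_of_dominated_loc_of_deriv_le (μ := volume) (x₀ := α)
    (s := Metric.ball α 1) (F := fun α w => dirB G (z + imV (coneMap α w)))
    (F' := fun α w => dirD (imV (nul (2 * α) 0 fun j => w (Sum.inl j))) (dirB G)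
      (z + imV (coneMap α w)))
    (bound := fun w : Fin d ⊕ Fin d → ℝ => C * (R + 1) * ((1 + ∑ i, w i ^ 2) ^ l)⁻¹)
    (Metric.ball_mem_nhds _ one_pos)
    (Filter.Eventually.of_forall fun β =>
      (continuous_comp_coneMap_slice hB hz β).aestronglyMeasurable)
    ((h' R).integrable (by omega) hR hB hz)
    (by
      simp only [dirD_imV_nul]
      refine Continuous.aestronglyMeasurable (continuous_const.mul ?_)
      refine (Continuous.add (continuous_const.mul (continuous_comp_coneMap_slice hA hz α))
        (continuous_const.mul (continuous_comp_coneMap_slice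
          (differentiableOn_dirD isOpen_tube hB _) hz α))).add ?_
      exact continuous_finsetSum _ fun j _ =>
        (by fun_prop : Continuous fun w : Fin d ⊕ Fin d → ℝ => (w (Sum.inl j) : ℂ)).mul
          (continuous_comp_coneMap_slice (hTB j) hz α))
    (ae_of_all _ fun w β hβ => by
      have hβR : |β| ≤ R := by
        have h1 : |β - α| < 1 := by simpa [Real.dist_eq] using hβ
        have h2 := abs_sub_abs_le_abs_sub β α
        simp only [R]; linarith
      refine (hb β hβR w z (Metric.mem_ball_self hr) _).trans ?_
      have hp : 0 < 1 + ∑ i, w i ^ 2 := by positivity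
      calc _ ≤ C * ((R + 1) * (1 + ∑ i, w i ^ 2)) * ((1 + ∑ i, w i ^ 2) ^ (l + 1))⁻¹ := by
            gcongr
            exact hnorm β hβR w
        _ = _ := by field_simp; ring)
    ((integrable_bracket hl).const_mul _)
    (ae_of_all _ fun w β _ => hasDerivAt_comp_imV isOpen_tube hB (hasDerivAt_coneMap β w)
      (add_imV_coneMap_mem hz β w))
  refine hder.2.congr_deriv ?_
  have hi1 : ∀ j, Integrable fun w : Fin d ⊕ Fin d → ℝ =>
      (w (Sum.inl j) : ℂ) * dirT j (dirB G) (z + imV (coneMap α w)) := fun j =>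
    integrable_coord_mul hl hR ((h' R).dirD hB _) (hTB j) hz (Sum.inl j)
  have hi2 : ∀ j, Integrable fun w => dirT j (dirT j G) (z + imV (coneMap α w)) := fun j =>
    (((h R).dirD hG _).dirD (differentiableOn_dirD isOpen_tube hG _) _).integrable hl hR
      (hTT j) hz
  have hpt : ∀ w : Fin d ⊕ Fin d → ℝ,
      dirD (imV (nul (2 * α) 0 fun j => w (Sum.inl j))) (dirB G) (z + imV (coneMap α w)) =
      -(I / 2) * (α * BoxOp G (z + imV (coneMap α w))) + ∑ j, I / 2 *
        (2 * (w (Sum.inl j) * dirT j (dirB G) (z + imV (coneMap α w))) +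
          α * dirT j (dirT j G) (z + imV (coneMap α w))) := by
    intro w
    have hbox := box_eq_frame isOpen_tube hG (add_imV_coneMap_mem hz α w) 0
    simp only [Pi.zero_apply, mul_zero, ne_eq, OfNat.ofNat_ne_zero, not_false_eq_true, zero_pow,
      Finset.sum_const_zero] at hbox
    rw [dirD_imV_nul, hbox, ← Finset.mul_sum, Finset.sum_add_distrib, ← Finset.mul_sum,
      ← Finset.mul_sum]
    simp only [dirT, dirB]
    push_cast
    ring
  have hi3 : ∀ j, Integrable fun w : Fin d ⊕ Fin d → ℝ => I / 2 *
        (2 * (w (Sum.inl j) * dirT j (dirB G) (z + imV (coneMap α w))) +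
          α * dirT j (dirT j G) (z + imV (coneMap α w))) := fun j =>
    (((hi1 j).const_mul 2).add ((hi2 j).const_mul (α : ℂ))).const_mul _
  have hsum : Integrable fun w : Fin d ⊕ Fin d → ℝ => ∑ j, I / 2 *
        (2 * (w (Sum.inl j) * dirT j (dirB G) (z + imV (coneMap α w))) +
          α * dirT j (dirT j G) (z + imV (coneMap α w))) :=
    integrable_finsetSum _ fun j _ => hi3 j
  have hbi : Integrable fun w => -(I / 2) * (α * BoxOp G (z + imV (coneMap α w))) := by
    refine (hder.1.sub hsum).congr (ae_of_all _ fun w => ?_)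
    simp only [Pi.sub_apply, hpt w]
    ring
  simp only [hpt]
  rw [integral_add hbi hsum, integral_finsetSum _ fun j _ => hi3 j, Finset.sum_eq_zero,
    add_zero, integral_const_mul, integral_const_mul, sliceInt]
  intro j _
  rw [integral_const_mul, integral_transverse hl hR hG hz (h R) (h' R), mul_zero]

end SliceDerivative

/-! ### The cone potential inverts the wave operator -/

section Inversion

variable {d : ℕ}

lemma Growth.add {k l : ℕ} {M N : ℝ} {f g : (Fin (d + 2) → ℂ) → ℂ} (hf : Growth k l M f)
    (hg : Growth k l N g) : Growth k l (M + N) (f + g) := fun z hz =>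
  (norm_add_le _ _).trans ((add_le_add (hf z hz) (hg z hz)).trans_eq (add_div _ _ _).symm)

lemma Growth.const_smul {k l : ℕ} {M : ℝ} {f : (Fin (d + 2) → ℂ) → ℂ} (hf : Growth k l M f)
    (c : ℂ) : Growth k l (‖c‖ * M) (c • f) := fun z hz => by
  rw [Pi.smul_apply, norm_smul, mul_div_assoc]
  exact mul_le_mul_of_nonneg_left (hf z hz) (norm_nonneg c)

lemma Growth.congr {k l : ℕ} {M : ℝ} {f g : (Fin (d + 2) → ℂ) → ℂ} (hf : Growth k l M f)
    (h : EqOn g f (tube (d + 2))) : Growth k l M g := fun z hz => by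
  rw [h hz]
  exact hf z hz

lemma add_imV_nul_zero (z : Fin (d + 2) → ℂ) : z + imV (nul 0 0 0) = z := by
  funext i
  refine Fin.cases ?_ (Fin.cases ?_ fun j => ?_) i <;> simp [imV]

lemma nA_tau_add_time {z : Fin (d + 2) → ℂ} (s : ℝ) :
    nA (imP (z + imV (nul 0 s 0))) = nA (imP z) ∧
      tau (imP (z + imV (nul 0 s 0))) = tau (imP z) + s := by
  have h : nul 0 s 0 = s • (nul 0 1 0 : Fin (d + 2) → ℝ) :=
    ext_fin_add_two (by simp; ring) (by simp; ring) fun j => by simp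
  rw [imP_add_imV, h]
  exact ⟨by rw [nA_add_smul_nul, mul_zero, add_zero], tau_add_smul_nul_time _ _⟩

lemma add_time_mem {z : Fin (d + 2) → ℂ} (hz : z ∈ tube (d + 2)) {s : ℝ} (hs : 0 ≤ s) :
    z + imV (nul 0 s 0) ∈ tube (d + 2) := by
  obtain ⟨h1, h2⟩ := nA_tau_add_time (z := z) s
  obtain ⟨h3, h4⟩ := mem_cone_iff.1 hz
  rw [mem_tube, mem_cone_iff, h1, h2]
  exact ⟨h3, by linarith⟩

lemma hasDerivAt_time {f : (Fin (d + 2) → ℂ) → ℂ} (hf : DifferentiableOn ℂ f (tube (d + 2)))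
    {z : Fin (d + 2) → ℂ} (hz : z ∈ tube (d + 2)) {s : ℝ} (hs : 0 ≤ s) :
    HasDerivAt (fun s => f (z + imV (nul 0 s 0))) (I * dirB f (z + imV (nul 0 s 0))) s := by
  have hγ : HasDerivAt (fun s => (nul 0 s 0 : Fin (d + 2) → ℝ)) (nul 0 1 0) s :=
    hasDerivAt_nul (hasDerivAt_const _ _) (hasDerivAt_id s) fun j => hasDerivAt_const _ _
  refine (hasDerivAt_comp_imV isOpen_tube hf hγ (add_time_mem hz hs)).congr_deriv ?_
  rw [dirD_imV_nul]
  simp [dirB]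

lemma Growth.norm_time_le {k q : ℕ} {M : ℝ} {f : (Fin (d + 2) → ℂ) → ℂ}
    (h : Growth k (k + q) M f) {z : Fin (d + 2) → ℂ} (hz : z ∈ tube (d + 2)) {s : ℝ}
    (hs : 0 ≤ s) : ‖f (z + imV (nul 0 s 0))‖ ≤
      M / (nA (imP z) ^ k * tau (imP z) ^ k) * ((tau (imP z) + s) ^ q)⁻¹ := by
  obtain ⟨h1, h2⟩ := nA_tau_add_time (z := z) s
  obtain ⟨h3, h4⟩ := mem_cone_iff.1 hz
  have hM := h.nonneg
  refine (h _ (add_time_mem hz hs)).trans ?_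
  rw [h1, h2, pow_add, ← mul_assoc, ← div_div, div_eq_mul_inv (M / _)]
  gcongr
  linarith

lemma eqOn_zero_of_dirB_eq_zero {k l : ℕ} (hl : l ≠ 0) {M : ℝ} {f : (Fin (d + 2) → ℂ) → ℂ}
    (hf : DifferentiableOn ℂ f (tube (d + 2))) (h : Growth k l M f)
    (h0 : EqOn (dirB f) 0 (tube (d + 2))) : EqOn f 0 (tube (d + 2)) := by
  intro z hz
  have hder : ∀ s ∈ Ici (0 : ℝ), HasDerivAt (fun s => f (z + imV (nul 0 s 0))) 0 s := by
    intro s hs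
    refine (hasDerivAt_time hf hz hs).congr_deriv ?_
    rw [h0 (add_time_mem hz hs), Pi.zero_apply, mul_zero]
  have hlim : Filter.Tendsto (fun s => f (z + imV (nul 0 s 0))) Filter.atTop (nhds 0) := by
    refine squeeze_zero_norm' (a := fun s => M / nA (imP z) ^ k * ((tau (imP z) + s) ^ l)⁻¹) ?_ ?_
    · filter_upwards [Filter.eventually_ge_atTop 0] with s hs
      refine (h _ (add_time_mem hz hs)).trans_eq ?_
      rw [(nA_tau_add_time s).1, (nA_tau_add_time s).2, ← div_div, div_eq_mul_inv (M / _)]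
    · have : Filter.Tendsto (fun s => (tau (imP z) + s) ^ l) Filter.atTop Filter.atTop :=
        (Filter.tendsto_pow_atTop hl).comp
          (Filter.tendsto_atTop_add_const_left _ _ Filter.tendsto_id)
      simpa using this.inv_tendsto_atTop.const_mul (M / nA (imP z) ^ k)
  have h1 := integral_Ioi_of_hasDerivAt_of_tendsto' hder integrableOn_zero hlim
  rw [integral_zero, add_imV_nul_zero, zero_sub, eq_comm, neg_eq_zero] at h1
  exact h1

lemma sliceInt_zero (hd : 1 ≤ d) : ∃ κ : ℂ, κ ≠ 0 ∧ ∀ (k : ℕ) (M : ℝ)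
    (f : (Fin (d + 2) → ℂ) → ℂ), DifferentiableOn ℂ f (tube (d + 2)) → Growth k k M f →
      ∀ z ∈ tube (d + 2), sliceInt (dirB^[d + 1] f) z 0 = κ * dirB f z := by
  obtain ⟨κ, hκ, h⟩ := exists_integral_radial hd
  refine ⟨κ, hκ, fun k M f hf hM z hz => ?_⟩
  choose C hC using fun q => Growth.dirB_iterate (d := d) k k q
  obtain ⟨-, ht⟩ := mem_cone_iff.1 hz
  have hdiff : ∀ q, DifferentiableOn ℂ (dirB^[q] f) (tube (d + 2)) := fun q =>
    (dirD_iterate_box isOpen_tube hf _ q).1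
  have key := h (fun q s => dirB^[q] f (z + imV (nul 0 s 0)))
    (fun q => C q * M / (nA (imP z) ^ k * tau (imP z) ^ k)) (tau (imP z)) ht
    (fun q s hs => by
      rw [Function.iterate_succ_apply']
      exact hasDerivAt_time (hdiff q) hz hs)
    (fun q s hs => (hC q M f hf hM).norm_time_le hz hs)
  simp only [Function.iterate_one, add_imV_nul_zero] at key
  rw [← key, sliceInt]
  refine integral_congr_ae (ae_of_all _ fun w => ?_)
  have e' : coneMap 0 w = nul 0 (∑ i, w i ^ 2) 0 := by
    simp only [coneMap, zero_pow two_ne_zero, zero_mul]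
    rfl
  simp only [e']

lemma tendsto_sliceInt {k l : ℕ} (hk : (d : ℝ) / 2 < k) (hl : d < l) {M : ℝ}
    {g : (Fin (d + 2) → ℂ) → ℂ} (h : Growth k l M g) {z : Fin (d + 2) → ℂ}
    (hz : z ∈ tube (d + 2)) : Filter.Tendsto (sliceInt g z) Filter.atTop (nhds 0) := by
  obtain ⟨ha, ht⟩ := mem_cone_iff.1 hz
  have hM := h.nonneg
  have hb0 := bracketInt_nonneg d l
  have hdk : d + 1 ≤ 2 * k := by
    have : (d : ℝ) < 2 * k := by linarith
    exact_mod_cast this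
  set c := M / nA (imP z) ^ k * (tau (imP z) ^ d * (tau (imP z) ^ l)⁻¹ * bracketInt d l)
  have hc : 0 ≤ c := by positivity
  refine squeeze_zero_norm (a := fun α : ℝ => c * (√((nA (imP z) + α ^ 2) / nA (imP z)))⁻¹)
    (fun α => ?_) ?_
  · obtain ⟨hi, hv⟩ := integrable_tau hl hz α
    set X := (nA (imP z) + α ^ 2) / nA (imP z) with hX
    have hX1 : 1 ≤ X := by
      rw [hX, one_le_div ha]
      linarith [sq_nonneg α]
    have hs1 : 1 ≤ √X := Real.one_le_sqrt.2 hX1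
    have hA : nA (imP z) + α ^ 2 = nA (imP z) * √X ^ 2 := by
      rw [Real.sq_sqrt (by linarith), hX]
      field_simp
    have h1 : √X ^ d * ((√X ^ 2) ^ k)⁻¹ ≤ (√X)⁻¹ := by
      rw [← pow_mul, ← div_eq_mul_inv, ← one_div, div_le_div_iff₀ (by positivity) (by positivity),
        one_mul, ← pow_succ]
      exact pow_le_pow_right₀ hs1 hdk
    calc ‖sliceInt g z α‖ ≤ ∫ w, M / (nA (imP z) + α ^ 2) ^ k *
          (tau (imP z + coneMap α w) ^ l)⁻¹ := by
          refine norm_integral_le_of_norm_le (hi.const_mul _) (ae_of_all _ fun w => ?_)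
          refine (h _ (add_imV_coneMap_mem hz α w)).trans_eq ?_
          rw [imP_add_imV, nA_add_coneMap, ← div_div, div_eq_mul_inv (M / _)]
      _ = c * (√X ^ d * ((√X ^ 2) ^ k)⁻¹) := by
          rw [integral_const_mul, hv, hA, mul_pow]
          simp only [c]
          field_simp
      _ ≤ _ := by gcongr
  · have h1 : Filter.Tendsto (fun α : ℝ => √((nA (imP z) + α ^ 2) / nA (imP z)))
        Filter.atTop Filter.atTop :=
      Real.tendsto_sqrt_atTop.comp ((Filter.tendsto_atTop_add_const_left _ _
        (Filter.tendsto_pow_atTop two_ne_zero)).atTop_div_const ha)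
    simpa using h1.inv_tendsto_atTop.const_mul c

/-- The cone potential inverts the wave operator on functions of suitable growth. -/
lemma exists_conePot_box (hd : 1 ≤ d) : ∃ c : ℂ, ∀ (k : ℕ) (M : ℝ)
    (f : (Fin (d + 2) → ℂ) → ℂ), (d : ℝ) / 2 < k → DifferentiableOn ℂ f (tube (d + 2)) →
      Growth k k M f → EqOn f (c • conePot (BoxOp f)) (tube (d + 2)) := by
  obtain ⟨κ, hκ, hκ0⟩ := sliceInt_zero hd
  refine ⟨κ⁻¹ * (I / 2), fun k M f hk hf hM => ?_⟩
  set c := κ⁻¹ * (I / 2)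
  have hk0 : k ≠ 0 := by
    have : (0 : ℝ) < k := lt_of_le_of_lt (by positivity) hk
    exact_mod_cast this.ne'
  obtain ⟨C, hC⟩ := exists_growth_conePot hd hk
  have hbf := differentiableOn_box isOpen_tube hf
  obtain ⟨hP, hPg, -, hPB⟩ := hC _ _ hbf (hM.box hf)
  have hcP : DifferentiableOn ℂ ((-c) • conePot (BoxOp f)) (tube (d + 2)) := hP.const_smul (-c)
  obtain ⟨C1, hC1⟩ := Growth.dirB_iterate (d := d) k k d
  obtain ⟨C2, hC2⟩ := Growth.dirB_iterate (d := d) k k (d + 1)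
  obtain ⟨C3, hC3⟩ := Growth.dirB_iterate (d := d) (k + 1) (k + 1) (d - 1)
  have hG := dirD_iterate_box isOpen_tube hf (nul 0 1 0) d
  have hGg := hC1 M f hf hM
  have hBg : Growth k (k + d + 1) (C2 * M) (dirB (dirB^[d] f)) := by
    have := hC2 M f hf hM
    rwa [Function.iterate_succ_apply'] at this
  have hdB : EqOn (dirB f) (c • dirB (conePot (BoxOp f))) (tube (d + 2)) := by
    intro z hz
    have hder : ∀ α ∈ Ici (0 : ℝ), HasDerivAt (sliceInt (dirB (dirB^[d] f)) z)
        (-(I / 2) * (α * sliceInt (BoxOp (dirB^[d] f)) z α)) α := fun α _ =>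
      hasDerivAt_sliceInt (by omega) hG.1 hz (hGg.sliceBound hz) (hBg.sliceBound hz) α
    have hfam := ((holFamily_cone hk
      (dirD_iterate_box isOpen_tube hbf (nul 0 1 0) (d - 1)).1 (by
        have := hC3 _ _ hbf (hM.box hf)
        rwa [show k + 1 + (d - 1) = k + d by omega] at this)).dirD isOpen_tube
          (nul 0 1 0)).integrable hz
    have hInt : Integrable (fun p : ℝ × (Fin d ⊕ Fin d → ℝ) => (p.1 : ℂ) *
        dirB^[d] (BoxOp f) (z + imV (coneMap p.1 p.2))) (coneMeas d) := by
      refine hfam.congr (ae_of_all _ fun p => ?_)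
      simp only [dirD_const_mul_translate]
      congr 1
      obtain ⟨e, rfl⟩ : ∃ e, d = e + 1 := ⟨d - 1, by omega⟩
      rw [Function.iterate_succ_apply']
      rfl
    have hsl : ∀ α : ℝ, ∫ w, (α : ℂ) * dirB^[d] (BoxOp f) (z + imV (coneMap α w)) =
        α * sliceInt (BoxOp (dirB^[d] f)) z α := by
      intro α
      rw [integral_const_mul, sliceInt]
      congr 1
      exact integral_congr_ae (ae_of_all _ fun w => hG.2 (add_imV_coneMap_mem hz α w))
    have hInt' := hInt.integral_prod_left
    simp only [hsl] at hInt'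
    have hFTC := integral_Ioi_of_hasDerivAt_of_tendsto' hder (hInt'.const_mul _)
      (tendsto_sliceInt hk (by omega) hBg hz)
    have h0 := hκ0 k M f hf hM z hz
    rw [Function.iterate_succ_apply'] at h0
    have hprod := integral_prod _ hInt
    simp only [hsl] at hprod
    rw [integral_const_mul, h0, zero_sub, ← hprod] at hFTC
    have hPz := hPB hz
    rw [Pi.smul_apply, hPz, smul_eq_mul]
    have : dirB f z = κ⁻¹ * (κ * dirB f z) := by rw [← mul_assoc, inv_mul_cancel₀ hκ, one_mul]
    rw [this, ← neg_eq_iff_eq_neg.2 hFTC]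
    simp only [c, coneMeas]
    ring
  have hu := eqOn_zero_of_dirB_eq_zero hk0 (hf.add hcP) (hM.add (hPg.const_smul (-c)))
    (fun z hz => by
      have h1 := dirD_add isOpen_tube hf hcP (nul 0 1 0) hz
      have h2 := dirD_const_smul isOpen_tube hP (-c) (nul 0 1 0) hz
      have h3 := hdB hz
      simp only [Pi.add_apply, Pi.smul_apply, smul_eq_mul, h2] at h1 h3
      rw [dirB, h1, Pi.zero_apply]
      rw [dirB, dirB] at h3
      rw [h3]; ring)
  intro z hz
  have h1 := hu hz
  simp only [Pi.add_apply, Pi.smul_apply, Pi.zero_apply, smul_eq_mul] at h1 ⊢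
  linear_combination h1

end Inversion

/-! ### Bloch-type estimates -/

section Bloch

variable {d : ℕ}

lemma exists_growth_of_growth_box_iterate (hd : 1 ≤ d) {k : ℕ} (hk : (d : ℝ) / 2 < k) (j : ℕ) :
    ∃ C : ℝ, ∀ (M N : ℝ) (f : (Fin (d + 2) → ℂ) → ℂ), DifferentiableOn ℂ f (tube (d + 2)) →
      Growth k k M f → Growth (k + j) (k + j) N (BoxOp^[j] f) → Growth k k (C * N) f := by
  obtain ⟨c, hc⟩ := exists_conePot_box hd
  induction j generalizing k with
  | zero => exact ⟨1, fun M N f _ _ h => by simpa using h⟩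
  | succ j ih =>
    obtain ⟨C₁, h₁⟩ := exists_growth_conePot hd hk
    obtain ⟨C₂, h₂⟩ := ih (k := k + 1) (by push_cast; linarith)
    refine ⟨‖c‖ * (C₁ * C₂), fun M N f hf hM hN => ?_⟩
    have hb := h₂ _ N (BoxOp f) (differentiableOn_box isOpen_tube hf) (hM.box hf) (by
      rw [show k + 1 + j = k + (j + 1) by ring]
      rwa [Function.iterate_succ_apply] at hN)
    have := ((h₁ _ _ (differentiableOn_box isOpen_tube hf) hb).2.1.const_smul c).congr
      (hc k M f hk hf hM)
    rwa [← mul_assoc C₁, ← mul_assoc] at this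

lemma exists_box_iterate_eq (hd : 1 ≤ d) {k : ℕ} (hk : (d : ℝ) / 2 < k) (j : ℕ) {N : ℝ}
    {h : (Fin (d + 2) → ℂ) → ℂ} (hh : DifferentiableOn ℂ h (tube (d + 2)))
    (hN : Growth (k + j) (k + j) N h) : ∃ (M : ℝ) (g : (Fin (d + 2) → ℂ) → ℂ),
      DifferentiableOn ℂ g (tube (d + 2)) ∧ Growth k k M g ∧
        EqOn (BoxOp^[j] g) h (tube (d + 2)) := by
  obtain ⟨c, hc⟩ := exists_conePot_box hd
  induction j generalizing h N with
  | zero => exact ⟨N, h, hh, hN, fun _ _ => rfl⟩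
  | succ j ih =>
    have hkj : (d : ℝ) / 2 < (k + j : ℕ) := by
      push_cast; linarith [(Nat.cast_nonneg j : (0 : ℝ) ≤ j)]
    obtain ⟨C, hC⟩ := exists_growth_conePot hd hkj
    obtain ⟨hP, hPg, hPb, -⟩ := hC N h hh hN
    obtain ⟨M, g, hg, hgM, hgb⟩ := ih (hP.const_smul c) (hPg.const_smul c)
    refine ⟨M, g, hg, hgM, fun z hz => ?_⟩
    rw [Function.iterate_succ_apply', box_congr isOpen_tube hgb hz,
      box_const_smul isOpen_tube hP c hz, Pi.smul_apply, hPb hz,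
      hc (k + (j + 1)) N h (by push_cast at hkj ⊢; linarith) hh hN hz, Pi.smul_apply]

lemma growth_iff_iSup_le {k : ℕ} {M : ℝ} (hM : 0 ≤ M) (f : (Fin (d + 2) → ℂ) → ℂ) :
    Growth k k M f ↔ (⨆ z ∈ tube (d + 2), ENNReal.ofReal (lor (imP z) ^ k * ‖f z‖)) ≤
      ENNReal.ofReal M := by
  simp only [iSup_le_iff, ENNReal.ofReal_le_ofReal_iff hM]
  refine forall₂_congr fun z hz => ?_
  obtain ⟨h1, h2⟩ := mem_cone_iff.1 hz
  rw [lor_eq_mul h1.ne', ← mul_pow, le_div_iff₀ (by positivity), mul_comm]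

lemma iSup_lt_top_iff {k : ℕ} (f : (Fin (d + 2) → ℂ) → ℂ) :
    (⨆ z ∈ tube (d + 2), ENNReal.ofReal (lor (imP z) ^ k * ‖f z‖)) < ⊤ ↔
      ∃ M, Growth k k M f := by
  constructor
  · intro h
    exact ⟨_, (growth_iff_iSup_le ENNReal.toReal_nonneg f).2 (ENNReal.ofReal_toReal h.ne).ge⟩
  · rintro ⟨M, h⟩
    exact ((growth_iff_iSup_le h.nonneg f).1 h).trans_lt ENNReal.ofReal_lt_top

end Bloch

/-! ### Solving the wave equation for polyharmonic data -/

section Almansi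

variable {n : ℕ} {U : Set (Fin n → ℂ)}

lemma dirD_mul (hU : IsOpen U) {f g : (Fin n → ℂ) → ℂ} (hf : DifferentiableOn ℂ f U)
    (hg : DifferentiableOn ℂ g U) (v : Fin n → ℂ) :
    EqOn (dirD v (f * g)) (dirD v f * g + f * dirD v g) U := by
  intro z hz
  have h := ((hf z hz).differentiableAt (hU.mem_nhds hz)).hasFDerivAt.mul
    ((hg z hz).differentiableAt (hU.mem_nhds hz)).hasFDerivAt
  rw [dirD, h.fderiv]
  simp [dirD]
  ring

variable (z₀ : Fin n → ℂ)

lemma dirD_single_coord (i : Fin n) (c : ℂ) :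
    dirD (Pi.single i 1) (fun z : Fin n → ℂ => c * (z i - z₀ i)) = fun _ => c := by
  funext z
  have h : HasFDerivAt (fun z : Fin n → ℂ => c * (z i - z₀ i))
      (c • (ContinuousLinearMap.proj i : (Fin n → ℂ) →L[ℂ] ℂ)) z :=
    ((hasFDerivAt_apply i z).sub_const (z₀ i)).const_mul c
  rw [dirD, h.fderiv]
  simp

/-- The Euler operator centred at `z₀`. -/
def euler (f : (Fin n → ℂ) → ℂ) (z : Fin n → ℂ) : ℂ := dirD (z - z₀) f z

lemma euler_eq_sum (f : (Fin n → ℂ) → ℂ) (z : Fin n → ℂ) :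
    euler z₀ f z = ∑ i, (z i - z₀ i) * dirD (Pi.single i 1) f z := by
  rw [euler, dirD, clm_apply_eq_sum]
  exact Finset.sum_congr rfl fun i _ => mul_comm _ _

lemma dilate_mem {z₀ : Fin n → ℂ} (hstar : StarConvex ℝ z₀ U) {z : Fin n → ℂ} (hz : z ∈ U)
    {s : ℝ} (hs : s ∈ Icc (0 : ℝ) 1) : z₀ + (s : ℂ) ^ 2 • (z - z₀) ∈ U := by
  have := hstar.add_smul_sub_mem hz (sq_nonneg s) (pow_le_one₀ hs.1 hs.2)
  convert this using 2
  funext i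
  simp

lemma dirD_const_mul_dilate {z₀ : Fin n → ℂ} (hU : IsOpen U) {g : (Fin n → ℂ) → ℂ}
    (hg : DifferentiableOn ℂ g U) (c t : ℂ) (v : Fin n → ℂ) {z : Fin n → ℂ}
    (hz : z₀ + t • (z - z₀) ∈ U) :
    dirD v (fun z => c * g (z₀ + t • (z - z₀))) z = c * t * dirD v g (z₀ + t • (z - z₀)) := by
  have h1 : HasFDerivAt (fun z : Fin n → ℂ => z₀ + t • (z - z₀))
      (t • ContinuousLinearMap.id ℂ (Fin n → ℂ)) z :=
    (((hasFDerivAt_id z).sub_const z₀).const_smul t).const_add z₀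
  have h2 : HasFDerivAt (fun z => c * g (z₀ + t • (z - z₀))) _ z :=
    (((hg _ hz).differentiableAt (hU.mem_nhds hz)).hasFDerivAt.comp z h1).const_mul c
  rw [dirD, h2.fderiv]
  simp [dirD]
  ring

variable [NeZero n]

/-- The signature of the Lorentz form. -/
def sgnL (i : Fin n) : ℂ := if i = 0 then 1 else -1

lemma sgnL_mul_self (i : Fin n) : sgnL i * sgnL i = 1 := by
  unfold sgnL
  split_ifs <;> norm_num

lemma sum_sgnL_mul (a : Fin n → ℂ) : ∑ i, sgnL i * a i = 2 * a 0 - ∑ i, a i := by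
  have h : ∀ i, sgnL i * a i = (if i = 0 then 2 * a i else 0) - a i := by
    intro i
    unfold sgnL
    split_ifs <;> ring
  simp [h, Finset.sum_sub_distrib]

lemma box_eq_sum (f : (Fin n → ℂ) → ℂ) (z : Fin n → ℂ) :
    BoxOp f z = -∑ i, sgnL i * dirD (Pi.single i 1) (dirD (Pi.single i 1) f) z := by
  rw [sum_sgnL_mul]
  rfl

/-- The Lorentz form centred at `z₀`. -/
def lorAt (z : Fin n → ℂ) : ℂ := lorC (z - z₀)

lemma lorAt_eq_sum (z : Fin n → ℂ) : lorAt z₀ z = ∑ i, sgnL i * (z i - z₀ i) ^ 2 := by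
  rw [sum_sgnL_mul]
  rfl

lemma differentiable_lorAt : Differentiable ℂ (lorAt z₀) := by
  have : lorAt z₀ = fun z => ∑ i, sgnL i * (z i - z₀ i) ^ 2 := funext (lorAt_eq_sum z₀)
  rw [this]
  fun_prop

lemma dirD_lorAt (v : Fin n → ℂ) :
    dirD v (lorAt z₀) = fun z => ∑ i, 2 * sgnL i * (z i - z₀ i) * v i := by
  funext z
  have h1 := hasDerivAt_comp_line (f := lorAt z₀) (z := z) (v := v) (ζ := 0) isOpen_univ
    (differentiable_lorAt z₀).differentiableOn (mem_univ _)
  have hi : ∀ i, HasDerivAt (fun ζ : ℂ => (z + ζ • v) i - z₀ i) (v i) 0 := by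
    intro i
    simpa using (((hasDerivAt_id (0 : ℂ)).mul_const (v i)).const_add (z i)).sub_const (z₀ i)
  have h2 : HasDerivAt (fun ζ : ℂ => lorAt z₀ (z + ζ • v))
      (∑ i, 2 * sgnL i * (z i - z₀ i) * v i) 0 := by
    simp only [lorAt_eq_sum]
    refine (HasDerivAt.fun_sum fun i _ => ((hi i).fun_pow 2).const_mul (sgnL i)).congr_deriv ?_
    refine Finset.sum_congr rfl fun i _ => ?_
    simp
    ring
  rw [zero_smul, add_zero] at h1
  exact h1.unique h2

lemma dirD_single_lorAt (i : Fin n) :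
    dirD (Pi.single i 1) (lorAt z₀) = fun z => 2 * sgnL i * (z i - z₀ i) := by
  rw [dirD_lorAt]
  funext z
  simp [Pi.single_apply]

lemma euler_lorAt_mul (hU : IsOpen U) {f : (Fin n → ℂ) → ℂ} (hf : DifferentiableOn ℂ f U)
    {z : Fin n → ℂ} (hz : z ∈ U) :
    euler z₀ (lorAt z₀ * f) z = lorAt z₀ z * (2 * f z + euler z₀ f z) := by
  rw [euler, dirD_mul hU (differentiable_lorAt z₀).differentiableOn hf _ hz, euler]
  simp only [Pi.add_apply, Pi.mul_apply, dirD_lorAt, Pi.sub_apply]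
  have : ∑ i, 2 * sgnL i * (z i - z₀ i) * (z i - z₀ i) = 2 * lorAt z₀ z := by
    rw [lorAt_eq_sum, Finset.mul_sum]
    exact Finset.sum_congr rfl fun i _ => by ring
  rw [this]
  ring

lemma box_lorAt_mul (hU : IsOpen U) {f : (Fin n → ℂ) → ℂ} (hf : DifferentiableOn ℂ f U)
    {z : Fin n → ℂ} (hz : z ∈ U) :
    BoxOp (lorAt z₀ * f) z = lorAt z₀ z * BoxOp f z - 2 * n * f z - 4 * euler z₀ f z := by
  have hQ : DifferentiableOn ℂ (lorAt z₀) U := (differentiable_lorAt z₀).differentiableOn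
  have hi : ∀ i : Fin n, dirD (Pi.single i 1) (dirD (Pi.single i 1) (lorAt z₀ * f)) z =
      2 * sgnL i * f z + 4 * sgnL i * ((z i - z₀ i) * dirD (Pi.single i 1) f z) +
        lorAt z₀ z * dirD (Pi.single i 1) (dirD (Pi.single i 1) f) z := by
    intro i
    have hd := differentiableOn_dirD hU hf (Pi.single i 1)
    have hL : DifferentiableOn ℂ (fun z : Fin n → ℂ => 2 * sgnL i * (z i - z₀ i)) U := by
      fun_prop
    have h1 := dirD_mul hU hQ hf (Pi.single i 1)
    rw [dirD_single_lorAt] at h1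
    rw [dirD_congr hU h1 _ hz, dirD_add hU (hL.mul hf) (hQ.mul hd) _ hz, Pi.add_apply,
      dirD_mul hU hL hf _ hz, dirD_mul hU hQ hd _ hz]
    simp only [Pi.add_apply, Pi.mul_apply, dirD_single_lorAt, dirD_single_coord]
    ring
  have hs : ∀ i : Fin n, sgnL i * dirD (Pi.single i 1) (dirD (Pi.single i 1) (lorAt z₀ * f)) z =
      2 * f z + 4 * ((z i - z₀ i) * dirD (Pi.single i 1) f z) +
        lorAt z₀ z * (sgnL i * dirD (Pi.single i 1) (dirD (Pi.single i 1) f) z) := by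
    intro i
    rw [hi]
    linear_combination (2 * f z + 4 * ((z i - z₀ i) * dirD (Pi.single i 1) f z)) *
      sgnL_mul_self i
  rw [box_eq_sum, box_eq_sum, euler_eq_sum]
  simp only [hs, Finset.sum_add_distrib, ← Finset.mul_sum, Finset.sum_const, Finset.card_univ,
    Fintype.card_fin, nsmul_eq_mul]
  ring

lemma euler_lorAt_pow_mul (hU : IsOpen U) {f : (Fin n → ℂ) → ℂ} (hf : DifferentiableOn ℂ f U)
    (j : ℕ) {z : Fin n → ℂ} (hz : z ∈ U) :
    euler z₀ (lorAt z₀ ^ j * f) z = lorAt z₀ z ^ j * (2 * j * f z + euler z₀ f z) := by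
  induction j with
  | zero => simp
  | succ j ih =>
    have hQ : DifferentiableOn ℂ (lorAt z₀ ^ j * f) U :=
      ((differentiable_lorAt z₀).differentiableOn.pow j).mul hf
    rw [pow_succ', mul_assoc, euler_lorAt_mul z₀ hU hQ hz, ih, Pi.mul_apply, Pi.pow_apply]
    push_cast
    ring

lemma box_lorAt_pow_mul (hU : IsOpen U) {f : (Fin n → ℂ) → ℂ} (hf : DifferentiableOn ℂ f U)
    (h0 : EqOn (BoxOp f) 0 U) (j : ℕ) {z : Fin n → ℂ} (hz : z ∈ U) :
    BoxOp (lorAt z₀ ^ (j + 1) * f) z =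
      -(j + 1) * lorAt z₀ z ^ j * (4 * euler z₀ f z + (2 * n + 4 * j) * f z) := by
  induction j with
  | zero =>
    rw [zero_add, pow_one, box_lorAt_mul z₀ hU hf hz, h0 hz]
    simp
    ring
  | succ j ih =>
    have hQ : DifferentiableOn ℂ (lorAt z₀ ^ (j + 1) * f) U :=
      ((differentiable_lorAt z₀).differentiableOn.pow (j + 1)).mul hf
    rw [pow_succ', mul_assoc, box_lorAt_mul z₀ hU hQ hz, ih, euler_lorAt_pow_mul z₀ hU hf _ hz,
      Pi.mul_apply, Pi.pow_apply]
    push_cast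
    ring

lemma box_const_mul_dilate {z₀ : Fin n → ℂ} (hU : IsOpen U) (hstar : StarConvex ℝ z₀ U)
    {g : (Fin n → ℂ) → ℂ} (hg : DifferentiableOn ℂ g U) (h0 : EqOn (BoxOp g) 0 U) (c : ℂ)
    {s : ℝ} (hs : s ∈ Icc (0 : ℝ) 1) {z : Fin n → ℂ} (hz : z ∈ U) :
    BoxOp (fun z => c * g (z₀ + (s : ℂ) ^ 2 • (z - z₀))) z = 0 := by
  have hi : ∀ i : Fin n, dirD (Pi.single i 1) (dirD (Pi.single i 1)
      fun z => c * g (z₀ + (s : ℂ) ^ 2 • (z - z₀))) z = c * (s : ℂ) ^ 2 * (s : ℂ) ^ 2 *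
        dirD (Pi.single i 1) (dirD (Pi.single i 1) g) (z₀ + (s : ℂ) ^ 2 • (z - z₀)) := by
    intro i
    have h1 : EqOn (dirD (Pi.single i 1) fun z => c * g (z₀ + (s : ℂ) ^ 2 • (z - z₀)))
        (fun z => c * (s : ℂ) ^ 2 * dirD (Pi.single i 1) g (z₀ + (s : ℂ) ^ 2 • (z - z₀))) U :=
      fun z hz => dirD_const_mul_dilate hU hg c _ _ (dilate_mem hstar hz hs)
    rw [dirD_congr hU h1 _ hz, dirD_const_mul_dilate hU (differentiableOn_dirD hU hg _) _ _ _
      (dilate_mem hstar hz hs)]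
  have h2 := h0 (dilate_mem hstar hz hs)
  rw [box_eq_sum] at h2
  rw [box_eq_sum]
  simp only [hi, mul_left_comm (sgnL _)]
  rw [← Finset.mul_sum, ← mul_neg, h2, Pi.zero_apply, mul_zero]

end Almansi

/-! ### Lifting solutions of the wave equation -/

section Lift

variable {n : ℕ} {U : Set (Fin n → ℂ)} {z₀ : Fin n → ℂ}

/-- A weighted mean of `g` over the segment joining `z₀` to `z`. -/
def dilInt (z₀ : Fin n → ℂ) (g : (Fin n → ℂ) → ℂ) (M : ℕ) (z : Fin n → ℂ) : ℂ :=
  ∫ s in Ioc (0 : ℝ) 1, 2 * (s : ℂ) ^ M * g (z₀ + (s : ℂ) ^ 2 • (z - z₀))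

lemma holFamily_dilate (hU : IsOpen U) (hstar : StarConvex ℝ z₀ U) {g : (Fin n → ℂ) → ℂ}
    (hg : DifferentiableOn ℂ g U) (M : ℕ) : HolFamily U (volume.restrict (Ioc (0 : ℝ) 1))
      fun z s => 2 * (s : ℂ) ^ M * g (z₀ + (s : ℂ) ^ 2 • (z - z₀)) where
  diff := by
    refine (ae_restrict_iff' measurableSet_Ioc).2 (.of_forall fun s hs => ?_)
    refine DifferentiableOn.const_mul (hg.comp (by fun_prop) fun z hz => ?_) _
    exact dilate_mem hstar hz (Ioc_subset_Icc_self hs)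
  meas := by
    intro z hz
    refine ContinuousOn.aestronglyMeasurable ?_ measurableSet_Ioc
    refine ContinuousOn.mul (by fun_prop) (hg.continuousOn.comp (by fun_prop) fun s hs => ?_)
    exact dilate_mem hstar hz (Ioc_subset_Icc_self hs)
  dom := by
    intro z hz
    obtain ⟨r, hr, hrU⟩ := Metric.nhds_basis_closedBall.mem_iff.1 (hU.mem_nhds hz)
    have hc : Continuous fun p : ℝ × (Fin n → ℂ) => z₀ + (p.1 : ℂ) ^ 2 • (p.2 - z₀) := by
      fun_prop
    obtain ⟨B, hB⟩ := (isCompact_Icc.prod (isCompact_closedBall z r)).exists_bound_of_continuousOn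
      (hg.continuousOn.comp (s := Icc (0 : ℝ) 1 ×ˢ Metric.closedBall z r) hc.continuousOn
        fun p hp => dilate_mem hstar (hrU hp.2) hp.1)
    refine ⟨r, hr, fun _ => 2 * B, integrable_const _, ?_⟩
    refine (ae_restrict_iff' measurableSet_Ioc).2 (.of_forall fun s hs w hw => ?_)
    have h1 : ‖g (z₀ + (s : ℂ) ^ 2 • (w - z₀))‖ ≤ B :=
      hB (s, w) ⟨Ioc_subset_Icc_self hs, Metric.ball_subset_closedBall hw⟩
    have h2 : s ^ M ≤ 1 := pow_le_one₀ hs.1.le hs.2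
    rw [norm_mul, norm_mul, norm_pow, Complex.norm_real, Real.norm_of_nonneg hs.1.le,
      Complex.norm_ofNat]
    calc 2 * s ^ M * ‖g (z₀ + (s : ℂ) ^ 2 • (w - z₀))‖ ≤ 2 * 1 * B := by gcongr
      _ = 2 * B := by ring

lemma euler_dilInt (hU : IsOpen U) (hstar : StarConvex ℝ z₀ U) {g : (Fin n → ℂ) → ℂ}
    (hg : DifferentiableOn ℂ g U) (M : ℕ) {z : Fin n → ℂ} (hz : z ∈ U) :
    2 * euler z₀ (dilInt z₀ g M) z + (M + 1) * dilInt z₀ g M z = 2 * g z := by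
  have hF := holFamily_dilate hU hstar hg M
  have h1 := hF.integrable hz
  have h2 := (hF.dirD hU (z - z₀)).integrable hz
  have h3 : euler z₀ (dilInt z₀ g M) z = ∫ s in Ioc (0 : ℝ) 1, dirD (z - z₀)
      (fun z => 2 * (s : ℂ) ^ M * g (z₀ + (s : ℂ) ^ 2 • (z - z₀))) z :=
    hF.dirD_integral hU (z - z₀) hz
  have hd : ∀ s ∈ uIcc (0 : ℝ) 1, HasDerivAt
      (fun s : ℝ => 2 * ((s : ℂ) ^ (M + 1) * g (z₀ + (s : ℂ) ^ 2 • (z - z₀))))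
      (2 * dirD (z - z₀) (fun z => 2 * (s : ℂ) ^ M * g (z₀ + (s : ℂ) ^ 2 • (z - z₀))) z +
        (M + 1) * (2 * (s : ℂ) ^ M * g (z₀ + (s : ℂ) ^ 2 • (z - z₀)))) s := by
    intro s hs
    rw [uIcc_of_le zero_le_one] at hs
    have hm := dilate_mem hstar hz hs
    rw [dirD_const_mul_dilate hU hg _ _ _ hm]
    have e1 : HasDerivAt (fun ζ : ℂ => ζ ^ 2) (2 * (s : ℂ)) s := by
      simpa using hasDerivAt_pow 2 (s : ℂ)
    have e2 := (hasDerivAt_comp_line hU hg hm).comp (s : ℂ) e1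
    have e3 := (((hasDerivAt_pow (M + 1) (s : ℂ)).mul e2).const_mul 2).comp_ofReal
    refine e3.congr_deriv ?_
    simp
    ring
  have key := intervalIntegral.integral_eq_sub_of_hasDerivAt hd
    ((intervalIntegrable_iff_integrableOn_Ioc_of_le zero_le_one).2
      ((h2.const_mul 2).add (h1.const_mul _)))
  rw [intervalIntegral.integral_of_le zero_le_one,
    integral_add (h2.const_mul 2) (h1.const_mul _), integral_const_mul, integral_const_mul,
    ← h3, ← dilInt] at key
  simpa using key

variable [NeZero n]

lemma box_dilInt (hU : IsOpen U) (hstar : StarConvex ℝ z₀ U) {g : (Fin n → ℂ) → ℂ}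
    (hg : DifferentiableOn ℂ g U) (h0 : EqOn (BoxOp g) 0 U) (M : ℕ) :
    EqOn (BoxOp (dilInt z₀ g M)) 0 U := by
  intro z hz
  refine (box_integral hU (holFamily_dilate hU hstar hg M) hz).trans ?_
  refine setIntegral_eq_zero_of_forall_eq_zero fun s hs => ?_
  exact box_const_mul_dilate hU hstar hg h0 _ (Ioc_subset_Icc_self hs) hz

lemma exists_box_lorAt_pow_mul_eq (hU : IsOpen U) (hstar : StarConvex ℝ z₀ U)
    {v : (Fin n → ℂ) → ℂ} (hv : DifferentiableOn ℂ v U) (h0 : EqOn (BoxOp v) 0 U) (j : ℕ) :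
    ∃ w, DifferentiableOn ℂ w U ∧ EqOn (BoxOp w) 0 U ∧
      EqOn (BoxOp (lorAt z₀ ^ (j + 1) * w)) (lorAt z₀ ^ j * v) U := by
  obtain ⟨M, hM⟩ : ∃ M, n + 2 * j = M + 1 :=
    Nat.exists_eq_succ_of_ne_zero (by have := NeZero.pos n; omega)
  have hd : DifferentiableOn ℂ (dilInt z₀ v M) U :=
    (holFamily_dilate hU hstar hv M).differentiableOn hU
  have hb := box_dilInt hU hstar hv h0 M
  have hc : EqOn (BoxOp ((-1 / (4 * (j + 1)) : ℂ) • dilInt z₀ v M)) 0 U := by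
    intro z hz
    rw [box_const_smul hU hd _ hz, Pi.smul_apply, hb hz, Pi.zero_apply, smul_zero]
  refine ⟨_, hd.const_smul _, hc, fun z hz => ?_⟩
  rw [mul_smul_comm, box_const_smul hU (((differentiable_lorAt z₀).differentiableOn.pow _).mul hd)
    _ hz, Pi.smul_apply, box_lorAt_pow_mul z₀ hU hd hb j hz]
  have he := euler_dilInt hU hstar hv M hz
  have hM' : (n : ℂ) + 2 * j = M + 1 := by exact_mod_cast hM
  have hj : (j : ℂ) + 1 ≠ 0 := by exact_mod_cast j.succ_ne_zero
  have : 4 * euler z₀ (dilInt z₀ v M) z + (2 * n + 4 * j) * dilInt z₀ v M z = 4 * v z := by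
    linear_combination 2 * he + 2 * dilInt z₀ v M z * hM'
  rw [this, smul_eq_mul, Pi.mul_apply, Pi.pow_apply]
  field_simp

lemma exists_box_iterate_lorAt_pow_mul_eq (hU : IsOpen U) (hstar : StarConvex ℝ z₀ U) (j : ℕ)
    {v : (Fin n → ℂ) → ℂ} (hv : DifferentiableOn ℂ v U) (h0 : EqOn (BoxOp v) 0 U) :
    ∃ w, DifferentiableOn ℂ w U ∧ EqOn (BoxOp w) 0 U ∧
      EqOn (BoxOp^[j] (lorAt z₀ ^ j * w)) v U := by
  induction j generalizing v with
  | zero => exact ⟨v, hv, h0, fun z _ => by simp⟩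
  | succ j ih =>
    obtain ⟨w₁, hw₁, h1, e1⟩ := ih hv h0
    obtain ⟨w, hw, h2, e2⟩ := exists_box_lorAt_pow_mul_eq hU hstar hw₁ h1 j
    refine ⟨w, hw, h2, fun z hz => ?_⟩
    rw [Function.iterate_succ_apply, box_iterate_congr hU e2 j hz, e1 hz]

lemma box_iterate_sub (hU : IsOpen U) {f g : (Fin n → ℂ) → ℂ} (hf : DifferentiableOn ℂ f U)
    (hg : DifferentiableOn ℂ g U) (k : ℕ) :
    EqOn (BoxOp^[k] (f - g)) (BoxOp^[k] f - BoxOp^[k] g) U := by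
  intro z hz
  have h : f - g = f + (-1 : ℂ) • g := by simp [sub_eq_add_neg]
  rw [h, box_iterate_add hU hf (hg.const_smul _) k hz, Pi.add_apply,
    box_iterate_const_smul hU hg _ k hz]
  simp [sub_eq_add_neg]

/-- Polyharmonic functions on a star-shaped domain lie in the range of the Box operator. -/
lemma exists_box_eq_of_box_iterate_eq_zero (hU : IsOpen U) (hstar : StarConvex ℝ z₀ U) (s : ℕ)
    {v : (Fin n → ℂ) → ℂ} (hv : DifferentiableOn ℂ v U) (h0 : EqOn (BoxOp^[s] v) 0 U) :
    ∃ u, DifferentiableOn ℂ u U ∧ EqOn (BoxOp u) v U := by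
  induction s generalizing v with
  | zero =>
    refine ⟨0, differentiableOn_const 0, fun z hz => ?_⟩
    rw [show v z = 0 from h0 hz]
    simpa using box_const_smul hU (differentiableOn_const (0 : ℂ)) 0 hz
  | succ s ih =>
    obtain ⟨w, hw, -, e⟩ := exists_box_iterate_lorAt_pow_mul_eq hU hstar (s + 1)
      (differentiableOn_box_iterate hU hv s) (by simpa only [Function.iterate_succ_apply'] using h0)
    have hQ : DifferentiableOn ℂ (lorAt z₀ ^ (s + 1) * w) U :=
      ((differentiable_lorAt z₀).differentiableOn.pow _).mul hw
    have hb := differentiableOn_box hU hQ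
    obtain ⟨u, hu, e'⟩ := ih (hv.sub hb) fun z hz => by
      rw [box_iterate_sub hU hv hb s hz, Pi.sub_apply, ← Function.iterate_succ_apply, e hz,
        sub_self, Pi.zero_apply]
    refine ⟨_, hu.add hQ, fun z hz => ?_⟩
    rw [box_add hU hu hQ hz, Pi.add_apply, e' hz, Pi.sub_apply, sub_add_cancel]

lemma exists_box_iterate_eq_of_box_iterate_eq_zero (hU : IsOpen U) (hstar : StarConvex ℝ z₀ U)
    (k s : ℕ) {v : (Fin n → ℂ) → ℂ} (hv : DifferentiableOn ℂ v U)
    (h0 : EqOn (BoxOp^[s] v) 0 U) :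
    ∃ u, DifferentiableOn ℂ u U ∧ EqOn (BoxOp^[k] u) v U := by
  induction k generalizing v s with
  | zero => exact ⟨v, hv, fun _ _ => rfl⟩
  | succ k ih =>
    obtain ⟨u₁, hu₁, e₁⟩ := exists_box_eq_of_box_iterate_eq_zero hU hstar s hv h0
    obtain ⟨u, hu, e⟩ := ih (s + 1) hu₁ fun z hz => by
      rw [Function.iterate_succ_apply, box_iterate_congr hU e₁ s hz, h0 hz]
    refine ⟨u, hu, fun z hz => ?_⟩
    rw [Function.iterate_succ_apply', box_congr hU e hz, e₁ hz]

end Lift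

section Bloch

variable {d : ℕ}

lemma starConvex_tube {z₀ : Fin (d + 2) → ℂ} (hz₀ : z₀ ∈ tube (d + 2)) :
    StarConvex ℝ z₀ (tube (d + 2)) := by
  have hsmul : ∀ (a : ℝ) (z : Fin (d + 2) → ℂ), 0 < a → z ∈ tube (d + 2) →
      a • z ∈ tube (d + 2) := by
    rintro a z ha ⟨h1, h2⟩
    have h3 : imP (a • z) = a • imP z := by
      funext i
      simp [imP]
    have h4 : lor (a • imP z) = a ^ 2 * lor (imP z) := by
      simp only [lor, Pi.smul_apply, smul_eq_mul, mul_pow, ← Finset.mul_sum]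
      ring
    rw [mem_tube, h3]
    exact ⟨h4 ▸ by positivity, mul_pos ha h2⟩
  refine starConvex_iff_forall_pos hz₀ |>.2 fun z hz a b ha hb _ => ?_
  exact add_mem_cone (hsmul a z₀ ha hz₀) (hsmul b z hb hz)

lemma exists_mem_tube : ∃ z, z ∈ tube (d + 2) := by
  refine ⟨imV (nul 1 1 0), ?_⟩
  rw [mem_tube, mem_cone_iff]
  simp [nA, tau, imP, imV]

lemma exists_growth_box_iterate {k : ℕ} {M : ℝ} {f : (Fin (d + 2) → ℂ) → ℂ}
    (hf : DifferentiableOn ℂ f (tube (d + 2))) (h : Growth k k M f) (j : ℕ) :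
    ∃ N, Growth (k + j) (k + j) N (BoxOp^[j] f) := by
  induction j with
  | zero => exact ⟨M, h⟩
  | succ j ih =>
    obtain ⟨N, hN⟩ := ih
    rw [Function.iterate_succ_apply']
    exact ⟨_, hN.box (differentiableOn_box_iterate isOpen_tube hf j)⟩

end Bloch

/-- Proposition: for `m ≥ k > n/2 − 1` the Bloch-type seminorms with `k`
and `m` derivatives are equivalent, modulo `Ker □^m`. -/
theorem bloch_norms_equivalent (n : ℕ) [NeZero n] (hn : 3 ≤ n) (k m : ℕ)
    (hk : (n : ℝ) / 2 - 1 < (k : ℝ)) (hkm : k ≤ m) :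
    (∃ C : ℝ, ∀ F : (Fin n → ℂ) → ℂ, DifferentiableOn ℂ F (tube n) →
      (⨆ z ∈ tube n, ENNReal.ofReal (lor (imP z) ^ k * ‖BoxOp^[k] F z‖)) < ⊤ →
      (⨆ z ∈ tube n, ENNReal.ofReal (lor (imP z) ^ k * ‖BoxOp^[k] F z‖)) ≤
        ENNReal.ofReal C *
          ⨆ z ∈ tube n, ENNReal.ofReal (lor (imP z) ^ m * ‖BoxOp^[m] F z‖)) ∧
    (∀ F : (Fin n → ℂ) → ℂ, DifferentiableOn ℂ F (tube n) →
      (⨆ z ∈ tube n, ENNReal.ofReal (lor (imP z) ^ m * ‖BoxOp^[m] F z‖)) < ⊤ →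
      ∃ G : (Fin n → ℂ) → ℂ, DifferentiableOn ℂ G (tube n) ∧
        Set.EqOn (BoxOp^[m] G) (BoxOp^[m] F) (tube n) ∧
        (⨆ z ∈ tube n, ENNReal.ofReal (lor (imP z) ^ k * ‖BoxOp^[k] G z‖)) < ⊤) := by
  obtain ⟨d, rfl⟩ := Nat.exists_eq_add_of_le' (show 2 ≤ n by omega)
  obtain ⟨j, rfl⟩ := Nat.exists_eq_add_of_le hkm
  have hd : 1 ≤ d := by omega
  have hk' : (d : ℝ) / 2 < k := by
    push_cast at hk
    linarith
  have hiter : ∀ F : (Fin (d + 2) → ℂ) → ℂ, BoxOp^[k + j] F = BoxOp^[j] (BoxOp^[k] F) := by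
    intro F
    rw [add_comm k j, Function.iterate_add_apply]
  simp only [hiter]
  constructor
  · obtain ⟨C, hC⟩ := exists_growth_of_growth_box_iterate hd hk' j
    refine ⟨max C 0, fun F hF hfin => ?_⟩
    have hFk := differentiableOn_box_iterate isOpen_tube hF k
    obtain ⟨M, hM⟩ := (iSup_lt_top_iff _).1 hfin
    have hlt := (iSup_lt_top_iff _).2 (exists_growth_box_iterate hFk hM j)
    obtain ⟨N, hN, -⟩ := ENNReal.lt_iff_exists_coe.1 hlt
    have hG : Growth (k + j) (k + j) N (BoxOp^[j] (BoxOp^[k] F)) :=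
      (growth_iff_iSup_le N.coe_nonneg _).2 (by rw [hN, ENNReal.ofReal_coe_nnreal])
    rw [hN, ← ENNReal.ofReal_coe_nnreal, ← ENNReal.ofReal_mul (le_max_right _ _)]
    exact (growth_iff_iSup_le (by positivity) _).1 ((hC M N _ hFk hM hG).mono
      (mul_le_mul_of_nonneg_right (le_max_left _ _) N.coe_nonneg))
  · intro F hF hfin
    have hFk := differentiableOn_box_iterate isOpen_tube hF k
    obtain ⟨N, hN⟩ := (iSup_lt_top_iff _).1 hfin
    obtain ⟨M, g, hg, hM, e⟩ := exists_box_iterate_eq hd hk' j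
      (differentiableOn_box_iterate isOpen_tube hFk j) hN
    obtain ⟨z₀, hz₀⟩ := exists_mem_tube (d := d)
    obtain ⟨u, hu, e'⟩ := exists_box_iterate_eq_of_box_iterate_eq_zero isOpen_tube
      (starConvex_tube hz₀) k j (hg.sub hFk) fun z hz => by
        rw [box_iterate_sub isOpen_tube hg hFk j hz, Pi.sub_apply, e hz, sub_self, Pi.zero_apply]
    have hG : EqOn (BoxOp^[k] (F + u)) g (tube (d + 2)) := by
      intro z hz
      rw [box_iterate_add isOpen_tube hF hu k hz, Pi.add_apply, e' hz, Pi.sub_apply,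
        add_sub_cancel]
    refine ⟨F + u, hF.add hu, fun z hz => ?_, (iSup_lt_top_iff _).2 ⟨M, hM.congr hG⟩⟩
    rw [box_iterate_congr isOpen_tube hG j hz, e hz]
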